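/- Let G with list assignment L and precolored path P be a minimal counterexample configuration for the precolored-path 5-choosability theorem, and let F be the cycle bounding the outer face of G. Then F has no chords, i.e., there is no edge of G joining two non-consecutive vertices of F. -/

import Mathlib

open Set

noncomputable section

/-- A drawing of a simple graph in the plane: vertices are mapped to distinct points,
each edge is realized by a simple arc joining the images of its endpoints, arcs do not
pass through vertex points, any two arcs realizing distinct edges meet in at most one
point, and no point of the plane that is not a vertex point lies on three or more arcs. -/
structure Drawing {V : Type} (G : SimpleGraph V) where
  pos : V → ℝ × ℝ
  pos_inj : Function.Injective pos
  arc : ∀ ⦃u v : V⦄, G.Adj u v → Path (pos u) (pos v)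
  arc_symm : ∀ ⦃u v : V⦄ (h : G.Adj u v), arc h.symm = (arc h).symm
  arc_inj : ∀ ⦃u v : V⦄ (h : G.Adj u v), Function.Injective ⇑(arc h)
  arc_vertex : ∀ ⦃u v : V⦄ (h : G.Adj u v) (t : unitInterval) (w : V),
    arc h t = pos w → t = 0 ∨ t = 1
  arc_meet_once : ∀ ⦃u v x y : V⦄ (h₁ : G.Adj u v) (h₂ : G.Adj x y),
    s(u, v) ≠ s(x, y) → (Set.range ⇑(arc h₁) ∩ Set.range ⇑(arc h₂)).Subsingleton
  arc_no_triple : ∀ ⦃u₁ v₁ u₂ v₂ u₃ v₃ : V⦄ (h₁ : G.Adj u₁ v₁) (h₂ : G.Adj u₂ v₂)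
    (h₃ : G.Adj u₃ v₃), s(u₁, v₁) ≠ s(u₂, v₂) → s(u₁, v₁) ≠ s(u₃, v₃) →
    s(u₂, v₂) ≠ s(u₃, v₃) →
    ∀ p ∈ Set.range ⇑(arc h₁) ∩ Set.range ⇑(arc h₂) ∩ Set.range ⇑(arc h₃),
      ∃ w : V, p = pos w

namespace Drawing

variable {V : Type} {G : SimpleGraph V} (D : Drawing G)

/-- The set of points used by the arc of an edge. -/
def arcSet ⦃u v : V⦄ (h : G.Adj u v) : Set (ℝ × ℝ) :=
  Set.range ⇑(D.arc h)

/-- The set of interior points of the arc of an edge. -/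
def arcInterior ⦃u v : V⦄ (h : G.Adj u v) : Set (ℝ × ℝ) :=
  ⇑(D.arc h) '' {t : unitInterval | t ≠ 0 ∧ t ≠ 1}

/-- All points of the plane used by the drawing. -/
def graphSet : Set (ℝ × ℝ) :=
  Set.range D.pos ∪ ⋃ (u : V) (v : V) (h : G.Adj u v), D.arcSet h

/-- A crossing of a drawing: a point interior to the arcs of two distinct edges. -/
def IsCrossing (p : ℝ × ℝ) : Prop :=
  ∃ (u v x y : V) (h₁ : G.Adj u v) (h₂ : G.Adj x y),
    s(u, v) ≠ s(x, y) ∧ p ∈ D.arcInterior h₁ ∧ p ∈ D.arcInterior h₂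

/-- A drawing is plane if it has no crossings. -/
def IsPlane : Prop := ∀ p : ℝ × ℝ, ¬ D.IsCrossing p

/-- The faces of a drawing are the connected components of the complement
of the drawing. -/
def IsFace (f : Set (ℝ × ℝ)) : Prop :=
  ∃ q : ℝ × ℝ, q ∉ D.graphSet ∧ f = connectedComponentIn D.graphSetᶜ q

/-- The outer (unbounded) face of a drawing. -/
def outerFace : Set (ℝ × ℝ) :=
  {p : ℝ × ℝ | p ∉ D.graphSet ∧
    ¬ Bornology.IsBounded (connectedComponentIn D.graphSetᶜ p)}

/-- A vertex lies on the outer face if its point is on the boundary of the outer face. -/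
def OnOuter (v : V) : Prop := D.pos v ∈ frontier D.outerFace

/-- The set of points of the plane used by the drawing of a walk. -/
def walkSet {a b : V} (W : G.Walk a b) : Set (ℝ × ℝ) :=
  D.pos '' {v : V | v ∈ W.support} ∪ ⋃ d ∈ W.darts, D.arcSet d.adj

/-- A closed walk bounds the outer face if the boundary of the outer face is exactly
the drawing of the walk. -/
def BoundsOuter {a : V} (W : G.Walk a a) : Prop :=
  frontier D.outerFace = D.walkSet W

end Drawing

/-- The open region enclosed by a set `S` (typically the drawing of a cycle):
all points outside `S` whose connected component in the complement of `S` is bounded. -/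
def enclosed (S : Set (ℝ × ℝ)) : Set (ℝ × ℝ) :=
  {p : ℝ × ℝ | p ∉ S ∧ Bornology.IsBounded (connectedComponentIn Sᶜ p)}

namespace Drawing

variable {V : Type} {G : SimpleGraph V} (D : Drawing G)

/-- The closed disc bounded by (the drawing of) a closed walk. -/
def closedDisc {a : V} (W : G.Walk a a) : Set (ℝ × ℝ) :=
  D.walkSet W ∪ enclosed (D.walkSet W)

/-- The endpoints of the (two) edges incident with a crossing point `p`. -/
def crossingEnds (p : ℝ × ℝ) : Set V :=
  {w : V | ∃ (z : V) (h : G.Adj w z), p ∈ D.arcInterior h}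

end Drawing

/-- A proper colouring of `G` from the lists `L`. -/
def IsListColoring {V : Type} (G : SimpleGraph V) (L : V → Finset ℕ) (c : V → ℕ) : Prop :=
  (∀ v, c v ∈ L v) ∧ ∀ ⦃u v : V⦄, G.Adj u v → c u ≠ c v

/-- `G` is colourable from the lists `L`. -/
def ListColorable {V : Type} (G : SimpleGraph V) (L : V → Finset ℕ) : Prop :=
  ∃ c : V → ℕ, IsListColoring G L c


/-- A counterexample configuration for the precolored-path 5-choosability theorem:
a plane graph `G` (on vertex set `Fin n`), a path `P` of length at most two contained in
the boundary of the outer face, and a list assignment `L` satisfying conditions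
(i)–(vi) of the theorem, such that `G` is not `L`-colorable. -/
structure Config where
  n : ℕ
  G : SimpleGraph (Fin n)
  D : Drawing G
  plane : D.IsPlane
  a : Fin n
  b : Fin n
  P : G.Walk a b
  P_path : P.IsPath
  P_len : P.length ≤ 2
  P_boundary : D.walkSet P ⊆ frontier D.outerFace
  L : Fin n → Finset ℕ
  size5 : ∀ v, ¬ D.OnOuter v → 5 ≤ (L v).card
  size3 : ∀ v, D.OnOuter v → v ∉ P.support → 3 ≤ (L v).card
  size1 : ∀ v ∈ P.support, (L v).card = 1
  no_adjacent_3 : ∀ u v, G.Adj u v → (L u).card = 3 → (L v).card ≠ 3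
  proper_on_P : ∀ u ∈ P.support, ∀ v ∈ P.support, G.Adj u v → L u ≠ L v
  common_neighbor : ∀ p₀ p₁ p₂ : Fin n, P.support = [p₀, p₁, p₂] →
    ∀ x, G.Adj x p₀ → G.Adj x p₁ → G.Adj x p₂ → L x ≠ L p₀ ∪ L p₁ ∪ L p₂
  not_colorable : ¬ ListColorable G L

/-- The number of vertices plus the number of edges of a configuration. -/
def Config.size (C : Config) : ℕ := C.n + C.G.edgeSet.ncard

/-- The length of the precolored path of a configuration. -/
def Config.plen (C : Config) : ℕ := C.P.length

/-- The total size of the lists of a configuration. -/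
def Config.lsize (C : Config) : ℕ := ∑ v : Fin C.n, (C.L v).card

/-- A minimal counterexample configuration: `|V(G)| + |E(G)|` is minimum, subject to
that the precolored path is as long as possible, and subject to that the total size of
the lists is minimum. -/
def Config.Minimal (C : Config) : Prop :=
  (∀ C' : Config, C.size ≤ C'.size) ∧
  (∀ C' : Config, C'.size = C.size → C'.plen ≤ C.plen) ∧
  (∀ C' : Config, C'.size = C.size → C'.plen = C.plen → C.lsize ≤ C'.lsize)

namespace NC

/-- The identification of the plane with `ℂ`. -/
def toC (p : ℝ × ℝ) : ℂ := Complex.equivRealProdCLM.symm p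

lemma toC_cont : Continuous toC := Complex.equivRealProdCLM.symm.continuous

lemma toC_inj : Function.Injective toC := Complex.equivRealProdCLM.symm.injective

lemma toC_sub (p q : ℝ × ℝ) : toC p - toC q = toC (p - q) := by
  simp [toC]

lemma norm_le_toC (p : ℝ × ℝ) : ‖p‖ ≤ ‖toC p‖ := by
  have h1 := Complex.abs_re_le_norm (toC p)
  have h2 := Complex.abs_im_le_norm (toC p)
  have e1 : (toC p).re = p.1 := by simp [toC]
  have e2 : (toC p).im = p.2 := by simp [toC]
  rw [e1] at h1
  rw [e2] at h2
  rw [Prod.norm_def]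
  exact max_le h1 h2

lemma toC_le_norm (p : ℝ × ℝ) : ‖toC p‖ ≤ 2 * ‖p‖ := by
  have h := Complex.norm_le_abs_re_add_abs_im (toC p)
  have e1 : (toC p).re = p.1 := by simp [toC]
  have e2 : (toC p).im = p.2 := by simp [toC]
  rw [e1, e2] at h
  have h1 : |p.1| ≤ ‖p‖ := norm_fst_le p
  have h2 : |p.2| ≤ ‖p‖ := norm_snd_le p
  linarith

/-- `z - p` has a continuous logarithm on `M`. -/
def HasLog (M : Set (ℝ × ℝ)) (p : ℝ × ℝ) : Prop :=
  ∃ f : ℝ × ℝ → ℂ, ContinuousOn f M ∧ ∀ z ∈ M, Complex.exp (f z) = toC z - toC p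

lemma re_pos_of_norm_lt {w : ℂ} (h : ‖w‖ < 1) : (1 + w) ∈ Complex.slitPlane := by
  left
  have := Complex.abs_re_le_norm w
  have := neg_abs_le w.re
  simp
  linarith

lemma HasLog.near {M : Set (ℝ × ℝ)} {s s' : ℝ × ℝ} (h : HasLog M s)
    (hs : ∀ z ∈ M, ‖toC s - toC s'‖ < ‖toC z - toC s‖) : HasLog M s' := by
  obtain ⟨f, hf, hfe⟩ := h
  have hne : ∀ z ∈ M, toC z - toC s ≠ 0 := fun z hz h0 => by
    have := hs z hz
    rw [h0, norm_zero] at this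
    exact absurd this (not_lt.2 (norm_nonneg _))
  have hsl : ∀ z ∈ M, (1 + (toC s - toC s') / (toC z - toC s)) ∈ Complex.slitPlane := by
    intro z hz
    apply re_pos_of_norm_lt
    rw [norm_div, div_lt_one (norm_pos_iff.2 (hne z hz))]
    exact hs z hz
  refine ⟨fun z => f z + Complex.log (1 + (toC s - toC s') / (toC z - toC s)), ?_, ?_⟩
  · refine hf.add (ContinuousOn.clog ?_ hsl)
    refine continuousOn_const.add (continuousOn_const.div ?_ hne)
    exact (toC_cont.sub continuous_const).continuousOn
  · intro z hz
    rw [Complex.exp_add, hfe z hz, Complex.exp_log (Complex.slitPlane_ne_zero (hsl z hz))]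
    have := hne z hz
    field_simp
    ring

lemma HasLog.far {M : Set (ℝ × ℝ)} {q : ℝ × ℝ} (hq : ∀ z ∈ M, ‖toC z‖ < ‖toC q‖) :
    HasLog M q := by
  by_cases hM : M = ∅
  · subst hM
    exact ⟨fun _ => 0, continuousOn_empty _, by simp⟩
  obtain ⟨z0, hz0⟩ := Set.nonempty_iff_ne_empty.2 hM
  have hq0 : toC q ≠ 0 := fun h => by
    have := hq z0 hz0
    rw [h, norm_zero] at this
    exact absurd this (not_lt.2 (norm_nonneg _))
  have hsl : ∀ z ∈ M, (1 + -(toC z / toC q)) ∈ Complex.slitPlane := by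
    intro z hz
    apply re_pos_of_norm_lt
    rw [norm_neg, norm_div, div_lt_one (norm_pos_iff.2 hq0)]
    exact hq z hz
  refine ⟨fun z => Complex.log (1 + -(toC z / toC q)) + Complex.log (-toC q), ?_, ?_⟩
  · refine ContinuousOn.add (ContinuousOn.clog ?_ hsl) continuousOn_const
    exact (continuous_const.add (toC_cont.div_const _).neg).continuousOn
  · intro z hz
    rw [Complex.exp_add, Complex.exp_log (Complex.slitPlane_ne_zero (hsl z hz)),
      Complex.exp_log (neg_ne_zero.2 hq0)]
    field_simp
    ring

lemma locConst {M : Set (ℝ × ℝ)} (hM : IsClosed M) {s : ℝ × ℝ} (hs : s ∉ M) :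
    ∃ V : Set (ℝ × ℝ), IsOpen V ∧ s ∈ V ∧ ∀ s' ∈ V, (HasLog M s ↔ HasLog M s') := by
  obtain ⟨ε, hε, hb⟩ := Metric.isOpen_iff.1 hM.isOpen_compl s hs
  refine ⟨Metric.ball s (ε / 4), Metric.isOpen_ball, Metric.mem_ball_self (by linarith), ?_⟩
  intro s' hs'
  have hd : ‖s - s'‖ < ε / 4 := by
    rw [← dist_eq_norm, dist_comm]; exact hs'
  have h1 : ‖toC s - toC s'‖ < ε / 2 := by
    rw [toC_sub]; have := toC_le_norm (s - s'); linarith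
  have h2 : ∀ z ∈ M, ε ≤ ‖toC z - toC s‖ := by
    intro z hz
    by_contra hlt
    push Not at hlt
    refine hb ?_ hz
    rw [Metric.mem_ball, dist_eq_norm]
    rw [toC_sub] at hlt
    exact lt_of_le_of_lt (norm_le_toC _) hlt
  constructor
  · intro h
    exact h.near fun z hz => by have := h2 z hz; linarith
  · intro h
    refine h.near fun z hz => ?_
    have := h2 z hz
    have h3 : ‖toC z - toC s‖ ≤ ‖toC z - toC s'‖ + ‖toC s - toC s'‖ := by
      have := norm_sub_le (toC z - toC s') (toC s - toC s')
      simpa using this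
    rw [norm_sub_rev]
    linarith

lemma hasLog_of_mem {M : Set (ℝ × ℝ)} (hM : IsClosed M) {p q : ℝ × ℝ}
    (hq : q ∈ connectedComponentIn Mᶜ p) (h : HasLog M q) : HasLog M p := by
  have hp : p ∈ Mᶜ := connectedComponentIn_nonempty_iff.1 ⟨q, hq⟩
  have hpc := mem_connectedComponentIn hp
  by_contra hcon
  have hpre : IsPreconnected (connectedComponentIn Mᶜ p) := isPreconnected_connectedComponentIn
  have o1 : IsOpen {s | s ∉ M ∧ HasLog M s} := by
    rw [isOpen_iff_forall_mem_open]
    rintro s ⟨hs, hl⟩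
    obtain ⟨V, hV, hsV, hh⟩ := locConst hM hs
    exact ⟨V ∩ Mᶜ, fun x hx => ⟨hx.2, (hh x hx.1).1 hl⟩, hV.inter hM.isOpen_compl, hsV, hs⟩
  have o2 : IsOpen {s | s ∉ M ∧ ¬ HasLog M s} := by
    rw [isOpen_iff_forall_mem_open]
    rintro s ⟨hs, hl⟩
    obtain ⟨V, hV, hsV, hh⟩ := locConst hM hs
    exact ⟨V ∩ Mᶜ, fun x hx => ⟨hx.2, fun h => hl ((hh x hx.1).2 h)⟩,
      hV.inter hM.isOpen_compl, hsV, hs⟩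
  have hsub := connectedComponentIn_subset Mᶜ p
  obtain ⟨x, -, hx⟩ := hpre _ _ o1 o2 (fun x hx => by
    by_cases hl : HasLog M x
    · exact Or.inl ⟨hsub hx, hl⟩
    · exact Or.inr ⟨hsub hx, hl⟩) ⟨q, hq, hsub hq, h⟩ ⟨p, hpc, hp, hcon⟩
  exact hx.2.2 hx.1.2

/-- If `p` is in an unbounded component of the complement of the compact set `M`, then
`z - p` has a logarithm on `M`. -/
lemma hasLog_of_unbounded {M : Set (ℝ × ℝ)} (hM : IsCompact M) {p : ℝ × ℝ}
    (h : ¬ Bornology.IsBounded (connectedComponentIn Mᶜ p)) : HasLog M p := by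
  obtain ⟨R, hR⟩ := hM.isBounded.exists_norm_le
  have : ∃ q ∈ connectedComponentIn Mᶜ p, 2 * R < ‖q‖ := by
    by_contra hcon
    push Not at hcon
    exact h (isBounded_iff_forall_norm_le.2 ⟨_, hcon⟩)
  obtain ⟨q, hq, hqR⟩ := this
  refine hasLog_of_mem hM.isClosed hq (HasLog.far fun z hz => ?_)
  have h1 := toC_le_norm z
  have h2 := norm_le_toC q
  have h3 := hR z hz
  linarith

lemma exists_global_log (h : ℝ × ℝ → ℂ) (hc : Continuous h) (h0 : ∀ z, h z ≠ 0) :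
    ∃ k : ℝ × ℝ → ℂ, Continuous k ∧ ∀ z, Complex.exp (k z) = h z := by
  obtain ⟨k, ⟨-, hk⟩, -⟩ :=
    Complex.isCoveringMapOn_exp.existsUnique_continuousMap_lifts (A := ℝ × ℝ)
      ⟨h, hc⟩ (a₀ := 0) (e₀ := Complex.log (h 0))
      (Complex.exp_log (h0 0)) (fun z => by simpa using h0 z)
  exact ⟨k, k.continuous, fun z => congrFun hk z⟩

lemma no_circle_log (p : ℝ × ℝ) (R : ℝ) (hR : 0 < R) (k : ℝ × ℝ → ℂ) (hk : Continuous k)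
    (h : ∀ z, ‖toC z - toC p‖ = R → Complex.exp (k z) = toC z - toC p) : False := by
  let γ : ℝ → ℝ × ℝ := fun θ =>
    Complex.equivRealProdCLM (toC p + R * Complex.exp (θ * Complex.I))
  have hγc : Continuous γ := Complex.equivRealProdCLM.continuous.comp (by fun_prop)
  have hγ : ∀ θ, toC (γ θ) - toC p = R * Complex.exp (θ * Complex.I) := by
    intro θ
    have : toC (γ θ) = toC p + R * Complex.exp (θ * Complex.I) :=
      Complex.equivRealProdCLM.symm_apply_apply _
    rw [this]
    ring
  have hn : ∀ θ, ‖toC (γ θ) - toC p‖ = R := by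
    intro θ
    rw [hγ, norm_mul, Complex.norm_exp_ofReal_mul_I, mul_one, Complex.norm_real,
      Real.norm_of_nonneg hR.le]
  have hR0 : (R : ℂ) ≠ 0 := by exact_mod_cast hR.ne'
  let g : ℝ → ℂ := fun θ => k (γ θ) - θ * Complex.I - Complex.log R
  have hgc : Continuous g := ((hk.comp hγc).sub (by fun_prop)).sub continuous_const
  have hg : ∀ θ, Complex.exp (g θ) = 1 := by
    intro θ
    simp only [g]
    rw [Complex.exp_sub, Complex.exp_sub, h _ (hn θ), hγ, Complex.exp_log hR0]
    have := Complex.exp_ne_zero (θ * Complex.I)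
    field_simp
  have hzint : ∀ θ, ∃ n : ℤ, g θ = n * (2 * Real.pi * Complex.I) := fun θ =>
    Complex.exp_eq_one_iff.1 (hg θ)
  have hconst : g 0 = g (2 * Real.pi) := by
    choose n hn using hzint
    have hpi : (2 * Real.pi * Complex.I : ℂ) ≠ 0 := Complex.two_pi_I_ne_zero
    have hcn : Continuous n := by
      have : Continuous fun θ => ((n θ : ℤ) : ℂ) := by
        have : (fun θ => ((n θ : ℤ) : ℂ)) = fun θ => g θ / (2 * Real.pi * Complex.I) := by
          funext θ
          rw [hn θ]
          field_simp
        rw [this]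
        exact hgc.div_const _
      exact Complex.isClosedEmbedding_intCast.isInducing.continuous_iff.2 this
    rw [hn, hn, PreconnectedSpace.constant inferInstance hcn]
  have hγ2 : γ 0 = γ (2 * Real.pi) := by
    simp only [γ]
    congr 2
    simp [Complex.exp_two_pi_mul_I]
  simp only [g] at hconst
  rw [hγ2] at hconst
  have : (2 * Real.pi * Complex.I : ℂ) = 0 := by
    have := hconst
    push_cast at this
    linear_combination this
  exact Complex.two_pi_I_ne_zero this

lemma frontier_component {M : Set (ℝ × ℝ)} (hM : IsClosed M) (p : ℝ × ℝ) :
    frontier (connectedComponentIn Mᶜ p) ⊆ M := by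
  intro x hx
  by_contra hxM
  have hU : IsOpen (connectedComponentIn Mᶜ p) := hM.isOpen_compl.connectedComponentIn
  rw [hU.frontier_eq] at hx
  have hV : IsOpen (connectedComponentIn Mᶜ x) := hM.isOpen_compl.connectedComponentIn
  obtain ⟨y, hy1, hy2⟩ := mem_closure_iff.1 hx.1 _ hV (mem_connectedComponentIn hxM)
  apply hx.2
  rw [connectedComponentIn_eq hy2, ← connectedComponentIn_eq hy1]
  exact mem_connectedComponentIn hxM

/-- Converse: a logarithm on `M` forces `p` into an unbounded component. -/
lemma unbounded_of_hasLog {M : Set (ℝ × ℝ)} (hM : IsCompact M) {p : ℝ × ℝ} (hp : p ∉ M)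
    (h : HasLog M p) : ¬ Bornology.IsBounded (connectedComponentIn Mᶜ p) := by
  classical
  intro hb
  obtain ⟨f, hf, hfe⟩ := h
  obtain ⟨g, hg⟩ := ContinuousMap.exists_restrict_eq hM.isClosed
    (⟨M.domRestrict f, continuousOn_iff_continuous_domRestrict.1 hf⟩ : C(M, ℂ))
  have hgM : ∀ z ∈ M, g z = f z := fun z hz => by
    have := congrArg (fun F : C(M, ℂ) => F ⟨z, hz⟩) hg
    exact this
  set U := connectedComponentIn Mᶜ p with hUdef
  let H : ℝ × ℝ → ℂ := fun z => if z ∈ U then Complex.exp (g z) else toC z - toC p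
  have hH : Continuous H := by
    refine Continuous.if (fun a ha => ?_) (Complex.continuous_exp.comp g.continuous)
      (toC_cont.sub continuous_const)
    have haM : a ∈ M := frontier_component hM.isClosed p ha
    rw [hgM a haM, hfe a haM]
  have hH0 : ∀ z, H z ≠ 0 := by
    intro z
    simp only [H]
    split_ifs with hz
    · exact Complex.exp_ne_zero _
    · intro h0
      apply hz
      rw [toC_inj (sub_eq_zero.1 h0)]
      exact mem_connectedComponentIn hp
  obtain ⟨k, hk, hke⟩ := exists_global_log H hH hH0
  obtain ⟨R, hR⟩ := hb.exists_norm_le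
  have hR0 : 0 ≤ R := (norm_nonneg _).trans (hR p (mem_connectedComponentIn hp))
  refine no_circle_log p (4 * R + 1) (by linarith) k hk fun z hz => ?_
  rw [hke]
  simp only [H]
  rw [if_neg]
  intro hzU
  have h1 := hR z hzU
  have h2 := hR p (mem_connectedComponentIn hp)
  have h3 := toC_le_norm z
  have h4 := toC_le_norm p
  have h5 := norm_sub_le (toC z) (toC p)
  linarith

/-- Janiszewski's theorem (separation from infinity). -/
lemma janiszewski {M N : Set (ℝ × ℝ)} (hM : IsCompact M) (hN : IsCompact N)
    (hMN : IsPreconnected (M ∩ N)) {p : ℝ × ℝ} (hp : p ∉ M ∪ N)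
    (h1 : ¬ Bornology.IsBounded (connectedComponentIn Mᶜ p))
    (h2 : ¬ Bornology.IsBounded (connectedComponentIn Nᶜ p)) :
    ¬ Bornology.IsBounded (connectedComponentIn (M ∪ N)ᶜ p) := by
  classical
  refine unbounded_of_hasLog (hM.union hN) hp ?_
  obtain ⟨f, hf, hfe⟩ := hasLog_of_unbounded hM h1
  obtain ⟨g, hg, hge⟩ := hasLog_of_unbounded hN h2
  have key : ∃ c : ℂ, Complex.exp c = 1 ∧ ∀ z ∈ M ∩ N, f z = g z + c := by
    rcases (M ∩ N).eq_empty_or_nonempty with he | ⟨z0, hz0⟩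
    · exact ⟨0, by simp, by simp [he]⟩
    have hzint : ∀ z : ↥(M ∩ N), ∃ n : ℤ, f z - g z = n * (2 * Real.pi * Complex.I) := by
      rintro ⟨z, hz⟩
      apply Complex.exp_eq_one_iff.1
      rw [Complex.exp_sub, hfe z hz.1, hge z hz.2, div_self]
      rw [← hfe z hz.1]
      exact Complex.exp_ne_zero _
    choose n hn using hzint
    have hpi : (2 * Real.pi * Complex.I : ℂ) ≠ 0 := Complex.two_pi_I_ne_zero
    have hcn : Continuous n := by
      have : Continuous fun z => ((n z : ℤ) : ℂ) := by
        have : (fun z => ((n z : ℤ) : ℂ)) =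
            fun z : ↥(M ∩ N) => (f z - g z) / (2 * Real.pi * Complex.I) := by
          funext z
          rw [hn z]
          field_simp
        rw [this]
        refine Continuous.div_const (Continuous.sub ?_ ?_) _
        · exact continuousOn_iff_continuous_domRestrict.1 (hf.mono inter_subset_left)
        · exact continuousOn_iff_continuous_domRestrict.1 (hg.mono inter_subset_right)
      exact Complex.isClosedEmbedding_intCast.isInducing.continuous_iff.2 this
    have : PreconnectedSpace ↥(M ∩ N) := isPreconnected_iff_preconnectedSpace.1 hMN
    refine ⟨n ⟨z0, hz0⟩ * (2 * Real.pi * Complex.I), ?_, ?_⟩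
    · exact Complex.exp_eq_one_iff.2 ⟨_, rfl⟩
    · intro z hz
      rw [PreconnectedSpace.constant inferInstance hcn (x := ⟨z0, hz0⟩) (y := ⟨z, hz⟩), ← hn]
      simp
  obtain ⟨c, hc, hcz⟩ := key
  have hgM : ∀ z ∈ N, (if z ∈ M then f z else g z + c) = g z + c := by
    intro z hz
    split_ifs with h
    · exact hcz z ⟨h, hz⟩
    · rfl
  refine ⟨fun z => if z ∈ M then f z else g z + c, ?_, ?_⟩
  · refine ContinuousOn.union_of_isClosed ?_ ?_ hM.isClosed hN.isClosed
    · exact hf.congr fun z hz => by simp [hz]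
    · exact (hg.add continuousOn_const).congr hgM
  · rintro z (hz | hz)
    · simp [hz, hfe]
    · show Complex.exp (if z ∈ M then f z else g z + c) = _
      rw [hgM z hz, Complex.exp_add, hc, hge z hz, mul_one]

end NC
namespace NC

/-- The union of the unbounded components of the complement of `X`. -/
def outer (X : Set (ℝ × ℝ)) : Set (ℝ × ℝ) :=
  {p | p ∉ X ∧ ¬ Bornology.IsBounded (connectedComponentIn Xᶜ p)}

lemma outer_mono {X Y : Set (ℝ × ℝ)} (h : X ⊆ Y) : outer Y ⊆ outer X := fun p hp =>
  ⟨fun hx => hp.1 (h hx), fun hb => hp.2 (hb.subset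
    (connectedComponentIn_mono p (compl_subset_compl.2 h)))⟩

lemma mem_frontier_outer {X : Set (ℝ × ℝ)} {q : ℝ × ℝ} (hq : q ∈ X)
    (h : q ∈ closure (outer X)) : q ∈ frontier (outer X) :=
  ⟨h, fun hi => (interior_subset hi).1 hq⟩

lemma frontier_outer_mono {X Y : Set (ℝ × ℝ)} (h : X ⊆ Y) {q : ℝ × ℝ} (hq : q ∈ X)
    (hf : q ∈ frontier (outer Y)) : q ∈ frontier (outer X) :=
  mem_frontier_outer hq (closure_mono (outer_mono h) hf.1)

lemma far_mem_outer {X : Set (ℝ × ℝ)} {R : ℝ} (hR : ∀ z ∈ X, ‖z‖ ≤ R) (hR0 : 0 ≤ R) {q : ℝ × ℝ}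
    (hq : R < ‖q‖) : q ∈ outer X := by
  refine ⟨fun h => absurd (hR q h) (not_le.2 hq), fun hb => ?_⟩
  have hpre : IsPreconnected ((fun t : ℝ => t • q) '' Ici 1) :=
    isPreconnected_Ici.image _ (by fun_prop)
  have hsub : (fun t : ℝ => t • q) '' Ici 1 ⊆ Xᶜ := by
    rintro _ ⟨t, ht, rfl⟩ hX
    have h1 := hR _ hX
    simp only [norm_smul, Real.norm_eq_abs] at h1
    have h2 : (1 : ℝ) ≤ |t| := le_trans ht (le_abs_self t)
    nlinarith [norm_nonneg q]
  have hs := hpre.subset_connectedComponentIn (x := q) ⟨1, by simp, by simp⟩ hsub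
  obtain ⟨B, hB⟩ := (hb.subset hs).exists_norm_le
  have hq0 : 0 < ‖q‖ := lt_of_le_of_lt hR0 hq
  have h3 := hB ((max 1 (B / ‖q‖ + 1)) • q) ⟨_, Set.mem_Ici.2 (le_max_left _ _), rfl⟩
  rw [norm_smul, Real.norm_of_nonneg (le_trans zero_le_one (le_max_left _ _))] at h3
  have h4 : (B / ‖q‖ + 1) * ‖q‖ ≤ max 1 (B / ‖q‖ + 1) * ‖q‖ :=
    mul_le_mul_of_nonneg_right (le_max_right _ _) hq0.le
  have h5 : (B / ‖q‖ + 1) * ‖q‖ = B + ‖q‖ := by field_simp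
  linarith

lemma isOpen_outer {X : Set (ℝ × ℝ)} (hX : IsClosed X) : IsOpen (outer X) := by
  rw [isOpen_iff_forall_mem_open]
  rintro p ⟨hp, hb⟩
  refine ⟨connectedComponentIn Xᶜ p, fun x hx => ⟨connectedComponentIn_subset _ _ hx, ?_⟩,
    hX.isOpen_compl.connectedComponentIn, mem_connectedComponentIn hp⟩
  rwa [← connectedComponentIn_eq hx]

lemma closure_outer {X : Set (ℝ × ℝ)} (hX : IsClosed X) {q : ℝ × ℝ}
    (hq : q ∈ closure (outer X)) (hqX : q ∉ X) : q ∈ outer X := by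
  obtain ⟨y, hy1, hy2⟩ := mem_closure_iff.1 hq _
    (hX.isOpen_compl.connectedComponentIn (x := q)) (mem_connectedComponentIn hqX)
  refine ⟨hqX, ?_⟩
  rw [connectedComponentIn_eq hy1]
  exact hy2.2

lemma spread {X X0 : Set (ℝ × ℝ)} (hX : IsCompact X) {p : ℝ × ℝ}
    (hW : ¬ Bornology.IsBounded (connectedComponentIn X0ᶜ p))
    (hcl : ∀ q ∈ closure (outer X), q ∉ X0 → q ∈ outer X) :
    connectedComponentIn X0ᶜ p ⊆ outer X := by
  obtain ⟨R, hR0, hR⟩ : ∃ R : ℝ, 0 ≤ R ∧ ∀ z ∈ X, ‖z‖ ≤ R := by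
    obtain ⟨R, hR⟩ := hX.isBounded.exists_norm_le
    exact ⟨max R 0, le_max_right _ _, fun z hz => (hR z hz).trans (le_max_left _ _)⟩
  obtain ⟨q, hq, hqR⟩ : ∃ q ∈ connectedComponentIn X0ᶜ p, R < ‖q‖ := by
    by_contra hcon
    push Not at hcon
    exact hW (isBounded_iff_forall_norm_le.2 ⟨_, hcon⟩)
  have hqo : q ∈ outer X := far_mem_outer hR hR0 hqR
  have hpre : IsPreconnected (connectedComponentIn X0ᶜ p) := isPreconnected_connectedComponentIn
  by_contra hcon
  obtain ⟨y, hy, hyo⟩ := Set.not_subset.1 hcon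
  have hsub := connectedComponentIn_subset X0ᶜ p
  obtain ⟨x, -, hx1, hx2⟩ := hpre (outer X) (closure (outer X))ᶜ (isOpen_outer hX.isClosed)
    isClosed_closure.isOpen_compl (fun x hx => by
      by_cases hxc : x ∈ closure (outer X)
      · exact Or.inl (hcl x hxc (hsub hx))
      · exact Or.inr hxc) ⟨q, hq, hqo⟩ ⟨y, hy, fun hyc => hyo (hcl y hyc (hsub hy))⟩
  exact hx2 (subset_closure hx1)

lemma side_unbounded {M Y I : Set (ℝ × ℝ)} (hM : IsClosed M) (hMY : M ⊆ Y)
    (hI : IsPreconnected I) (hIM : ∀ x ∈ I, x ∉ M) {p q : ℝ × ℝ} (hp : p ∈ I) (hq : q ∈ I)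
    (hqY : q ∈ closure (outer Y)) : ¬ Bornology.IsBounded (connectedComponentIn Mᶜ p) := by
  have hqC : q ∈ connectedComponentIn Mᶜ p := hI.subset_connectedComponentIn hp hIM hq
  obtain ⟨o, ho1, ho2⟩ := mem_closure_iff.1 hqY _
    (hM.isOpen_compl.connectedComponentIn (x := p)) hqC
  rw [connectedComponentIn_eq ho1]
  exact (outer_mono hMY ho2).2

section Draw

variable {V : Type} {G : SimpleGraph V} (D : Drawing G)

/-- The drawing of the subgraph induced by `S`. -/
def drawSet (S : Set V) : Set (ℝ × ℝ) :=
  {q | (∃ w ∈ S, q = D.pos w) ∨ ∃ (x y : V) (h : G.Adj x y), x ∈ S ∧ y ∈ S ∧ q ∈ D.arcSet h}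

lemma drawSet_mono {S T : Set V} (h : S ⊆ T) : drawSet D S ⊆ drawSet D T := by
  rintro q (⟨w, hw, rfl⟩ | ⟨x, y, hxy, hx, hy, hq⟩)
  · exact Or.inl ⟨w, h hw, rfl⟩
  · exact Or.inr ⟨x, y, hxy, h hx, h hy, hq⟩

lemma graphSet_eq : D.graphSet = drawSet D univ := by
  ext q
  simp only [Drawing.graphSet, drawSet, mem_union, mem_range, mem_iUnion, mem_ofPred_eq]
  constructor
  · rintro (⟨w, rfl⟩ | ⟨x, y, h, hq⟩)
    · exact Or.inl ⟨w, trivial, rfl⟩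
    · exact Or.inr ⟨x, y, h, trivial, trivial, hq⟩
  · rintro (⟨w, -, rfl⟩ | ⟨x, y, h, -, -, hq⟩)
    · exact Or.inl ⟨w, rfl⟩
    · exact Or.inr ⟨x, y, h, hq⟩

lemma arcSet_symm {u v : V} (h : G.Adj u v) : D.arcSet h.symm = D.arcSet h := by
  simp [Drawing.arcSet, D.arc_symm h, Path.symm_range]

lemma pos_left_mem {u v : V} (h : G.Adj u v) : D.pos u ∈ D.arcSet h := ⟨0, by simp⟩

lemma pos_right_mem {u v : V} (h : G.Adj u v) : D.pos v ∈ D.arcSet h := ⟨1, by simp⟩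

lemma arc_pos {u v w : V} (h : G.Adj u v) (hw : D.pos w ∈ D.arcSet h) : w = u ∨ w = v := by
  obtain ⟨t, ht⟩ := hw
  rcases D.arc_vertex h t w ht with rfl | rfl
  · left; apply D.pos_inj; rw [← ht]; simp
  · right; apply D.pos_inj; rw [← ht]; simp

lemma arcSet_compact {u v : V} (h : G.Adj u v) : IsCompact (D.arcSet h) :=
  isCompact_range (D.arc h).continuous

lemma drawSet_compact [Finite V] (S : Set V) : IsCompact (drawSet D S) := by
  have : drawSet D S = D.pos '' S ∪ ⋃ (x : V) (y : V) (h : G.Adj x y ∧ x ∈ S ∧ y ∈ S),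
      D.arcSet h.1 := by
    ext q
    simp only [drawSet, mem_ofPred_eq, mem_union, mem_image, mem_iUnion]
    constructor
    · rintro (⟨w, hw, rfl⟩ | ⟨x, y, h, hx, hy, hq⟩)
      · exact Or.inl ⟨w, hw, rfl⟩
      · exact Or.inr ⟨x, y, ⟨h, hx, hy⟩, hq⟩
    · rintro (⟨w, hw, rfl⟩ | ⟨x, y, ⟨h, hx, hy⟩, hq⟩)
      · exact Or.inl ⟨w, hw, rfl⟩
      · exact Or.inr ⟨x, y, h, hx, hy, hq⟩
  rw [this]
  refine (S.toFinite.image _).isCompact.union ?_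
  exact isCompact_iUnion fun x => isCompact_iUnion fun y => isCompact_iUnion fun h =>
    arcSet_compact D h.1

lemma pos_mem_drawSet {S : Set V} {w : V} : D.pos w ∈ drawSet D S ↔ w ∈ S := by
  constructor
  · rintro (⟨x, hx, he⟩ | ⟨x, y, h, hx, hy, hq⟩)
    · rwa [D.pos_inj he]
    · rcases arc_pos D h hq with rfl | rfl <;> assumption
  · exact fun h => Or.inl ⟨w, h, rfl⟩

variable {D} in
lemma arc_meet (hpl : D.IsPlane) {u v x y : V} (h₁ : G.Adj u v) (h₂ : G.Adj x y)
    (hne : s(u, v) ≠ s(x, y)) {q : ℝ × ℝ} (hq1 : q ∈ D.arcSet h₁) (hq2 : q ∈ D.arcSet h₂) :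
    ∃ w, q = D.pos w := by
  by_contra hcon
  obtain ⟨t1, ht1⟩ := hq1
  obtain ⟨t2, ht2⟩ := hq2
  refine hpl q ⟨u, v, x, y, h₁, h₂, hne, ⟨t1, ⟨?_, ?_⟩, ht1⟩, ⟨t2, ⟨?_, ?_⟩, ht2⟩⟩
  · rintro rfl; exact hcon ⟨u, by rw [← ht1]; simp⟩
  · rintro rfl; exact hcon ⟨v, by rw [← ht1]; simp⟩
  · rintro rfl; exact hcon ⟨x, by rw [← ht2]; simp⟩
  · rintro rfl; exact hcon ⟨y, by rw [← ht2]; simp⟩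

variable {D} in
lemma drawSet_inter (hpl : D.IsPlane) (S T : Set V) :
    drawSet D S ∩ drawSet D T ⊆ drawSet D (S ∩ T) := by
  rintro q ⟨hS, hT⟩
  by_cases hw : ∃ w, q = D.pos w
  · obtain ⟨w, rfl⟩ := hw
    exact (pos_mem_drawSet D).2 ⟨(pos_mem_drawSet D).1 hS, (pos_mem_drawSet D).1 hT⟩
  rcases hS with ⟨w, -, h⟩ | ⟨x, y, h, hx, hy, hq⟩
  · exact absurd ⟨w, h⟩ hw
  rcases hT with ⟨w, -, h⟩ | ⟨x', y', h', hx', hy', hq'⟩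
  · exact absurd ⟨w, h⟩ hw
  by_cases he : s(x, y) = s(x', y')
  · rcases Sym2.eq_iff.1 he with ⟨rfl, rfl⟩ | ⟨rfl, rfl⟩
    · exact Or.inr ⟨x, y, h, ⟨hx, hx'⟩, ⟨hy, hy'⟩, hq⟩
    · exact Or.inr ⟨x, y, h, ⟨hx, hy'⟩, ⟨hy, hx'⟩, hq⟩
  · exact absurd (arc_meet hpl h h' he hq hq') hw

lemma drawSet_singleton {v : V} {q : ℝ × ℝ} {S : Set V} (hS : S ⊆ {v}) (h : q ∈ drawSet D S) :
    q = D.pos v := by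
  rcases h with ⟨w, hw, rfl⟩ | ⟨x, y, h, hx, hy, hq⟩
  · rw [hS hw]
  · rw [hS hx, hS hy] at h
    exact absurd h (G.loopless.irrefl v)

variable {D} in
/-- The key topological fact: an edge between two vertices on the outer boundary is on
the outer boundary of each piece of the graph left by removing its ends. -/
lemma edge_outer [Finite V] (hpl : D.IsPlane) {u v : V} (h : G.Adj u v) {K : Set V}
    (huK : u ∉ K) (hvK : v ∉ K) (hK : IsPreconnected (drawSet D K)) {Y : Set (ℝ × ℝ)}
    (hY : drawSet D (insert u (insert v K)) ⊆ Y)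
    (hu : D.pos u ∈ closure (outer Y)) (hv : D.pos v ∈ closure (outer Y)) :
    D.arcSet h ⊆ closure (outer (drawSet D (insert u (insert v K)))) := by
  have huv : u ≠ v := h.ne
  set X := drawSet D (insert u (insert v K)) with hXdef
  have hXc : IsCompact X := drawSet_compact D _
  rintro _ ⟨τ, rfl⟩
  by_contra hp
  have hcl := closure_mono (outer_mono hY)
  have hτ0 : τ ≠ 0 := by
    rintro rfl
    apply hp
    simpa using hcl hu
  have hτ1 : τ ≠ 1 := by
    rintro rfl
    apply hp
    simpa using hcl hv
  have hτ0' : 0 < τ := lt_of_le_of_ne unitInterval.nonneg' hτ0.symm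
  have hτ1' : τ < 1 := lt_of_le_of_ne unitInterval.le_one' hτ1
  have hinj := D.arc_inj h
  have harcX : D.arcSet h ⊆ X := fun q hq =>
    Or.inr ⟨u, v, h, by simp, by simp, hq⟩
  have harc2 : D.arcSet h ⊆ drawSet D {u, v} := fun q hq =>
    Or.inr ⟨u, v, h, by simp, by simp, hq⟩
  obtain ⟨s, t, ⟨hsτ, hτt⟩, hst⟩ := (mem_nhds_iff_exists_Ioo_subset' ⟨0, hτ0'⟩ ⟨1, hτ1'⟩).1
    ((isClosed_closure.isOpen_compl.preimage (D.arc h).continuous).mem_nhds hp)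
  -- arc points in the two sides
  have hAu : ∀ r, D.arc h r ∈ drawSet D (insert u K) → r = 0 := by
    intro r hr
    have h1 := drawSet_inter hpl _ _ ⟨harc2 ⟨r, rfl⟩, hr⟩
    have h2 := drawSet_singleton D (v := u) (by
      rintro x ⟨hx1, hx2⟩
      rcases hx1 with rfl | rfl
      · rfl
      · rcases hx2 with hx2 | hx2
        · exact absurd hx2.symm huv
        · exact absurd hx2 hvK) h1
    apply hinj
    simpa using h2
  have hAv : ∀ r, D.arc h r ∈ drawSet D (insert v K) → r = 1 := by
    intro r hr
    have h1 := drawSet_inter hpl _ _ ⟨harc2 ⟨r, rfl⟩, hr⟩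
    have h2 := drawSet_singleton D (v := v) (by
      rintro x ⟨hx1, hx2⟩
      rcases hx1 with rfl | rfl
      · rcases hx2 with hx2 | hx2
        · exact absurd hx2 huv
        · exact absurd hx2 huK
      · rfl) h1
    apply hinj
    simpa using h2
  set Mu := drawSet D (insert u K) ∪ D.arc h '' Iic s with hMu
  set Mv := drawSet D (insert v K) ∪ D.arc h '' Ici t with hMv
  have hMuc : IsCompact Mu := (drawSet_compact D _).union
    (isClosed_Iic.isCompact.image (D.arc h).continuous)
  have hMvc : IsCompact Mv := (drawSet_compact D _).union
    (isClosed_Ici.isCompact.image (D.arc h).continuous)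
  have hMuX : Mu ⊆ X := union_subset (drawSet_mono D (by
      rintro x (rfl | hx)
      · simp
      · simp [hx])) (fun q ⟨r, _, hr⟩ => harcX ⟨r, hr⟩)
  have hMvX : Mv ⊆ X := union_subset (drawSet_mono D (by
      rintro x (rfl | hx)
      · simp
      · simp [hx])) (fun q ⟨r, _, hr⟩ => harcX ⟨r, hr⟩)
  have hnu : ∀ r, s < r → D.arc h r ∉ Mu := by
    rintro r hr (hr' | ⟨r', hr', he⟩)
    · rw [hAu r hr'] at hr
      exact absurd hr (not_lt.2 unitInterval.nonneg')
    · rw [hinj he] at hr'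
      exact absurd hr (not_lt.2 hr')
  have hnv : ∀ r, r < t → D.arc h r ∉ Mv := by
    rintro r hr (hr' | ⟨r', hr', he⟩)
    · rw [hAv r hr'] at hr
      exact absurd hr (not_lt.2 unitInterval.le_one')
    · rw [hinj he] at hr'
      exact absurd hr (not_lt.2 hr')
  have hinter : Mu ∩ Mv = drawSet D K := by
    apply Subset.antisymm
    · rintro q ⟨hq1 | ⟨r, hr, rfl⟩, hq2⟩
      · rcases hq2 with hq2 | ⟨r, hr, rfl⟩
        · refine drawSet_mono D ?_ (drawSet_inter hpl _ _ ⟨hq1, hq2⟩)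
          rintro x ⟨rfl | hx1, hx2⟩
          · rcases hx2 with hx2 | hx2
            · exact absurd hx2 huv
            · exact hx2
          · exact hx1
        · rw [hAu r hq1] at hr
          exact absurd (hτ0'.trans hτt) (not_lt.2 hr)
      · exact absurd hq2 (hnv r (lt_of_le_of_lt hr (hsτ.trans hτt)))
    · exact subset_inter ((drawSet_mono D (subset_insert _ _)).trans subset_union_left)
        ((drawSet_mono D (subset_insert _ _)).trans subset_union_left)
  have hW : ¬ Bornology.IsBounded (connectedComponentIn (Mu ∪ Mv)ᶜ (D.arc h τ)) := by
    refine janiszewski hMuc hMvc (hinter ▸ hK) ?_ ?_ ?_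
    · rintro (h1 | h1)
      · exact hnu τ hsτ h1
      · exact hnv τ hτt h1
    · refine side_unbounded (I := D.arc h '' Ioi s) (q := D.pos v) hMuc.isClosed
        (hMuX.trans hY) (isPreconnected_Ioi.image _ (D.arc h).continuous.continuousOn) ?_
        ⟨τ, hsτ, rfl⟩ ⟨1, hsτ.trans hτ1', by simp⟩ hv
      rintro _ ⟨r, hr, rfl⟩
      exact hnu r hr
    · refine side_unbounded (I := D.arc h '' Iio t) (q := D.pos u) hMvc.isClosed
        (hMvX.trans hY) (isPreconnected_Iio.image _ (D.arc h).continuous.continuousOn) ?_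
        ⟨τ, hτt, rfl⟩ ⟨0, hτ0'.trans hτt, by simp⟩ hu
      rintro _ ⟨r, hr, rfl⟩
      exact hnv r hr
  have hXsub : ∀ q ∈ X, q ∉ Mu ∪ Mv → ∃ r ∈ Ioo s t, q = D.arc h r := by
    have haux : ∀ q ∈ D.arcSet h, q ∉ Mu ∪ Mv → ∃ r ∈ Ioo s t, q = D.arc h r := by
      rintro _ ⟨r, rfl⟩ hq
      refine ⟨r, ⟨?_, ?_⟩, rfl⟩
      · by_contra hr
        exact hq (Or.inl (Or.inr ⟨r, not_lt.1 hr, rfl⟩))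
      · by_contra hr
        exact hq (Or.inr (Or.inr ⟨r, not_lt.1 hr, rfl⟩))
    rintro q (⟨w, hw, rfl⟩ | ⟨x, y, hxy, hx, hy, hq⟩) hq'
    · exfalso
      rcases hw with rfl | hw
      · exact hq' (Or.inl (Or.inl ((pos_mem_drawSet D).2 (by simp))))
      · exact hq' (Or.inr (Or.inl ((pos_mem_drawSet D).2 hw)))
    · rcases hx with rfl | hx
      · rcases hy with rfl | rfl | hy
        · exact absurd hxy (G.loopless.irrefl _)
        · exact haux q hq hq'
        · exact absurd (Or.inl (Or.inl (Or.inr ⟨_, _, hxy, by simp, by simp [hy], hq⟩))) hq'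
      · rcases hy with rfl | hy
        · rcases hx with rfl | hx
          · exact haux q (by rwa [← arcSet_symm D h]) hq'
          · exact absurd (Or.inl (Or.inl (Or.inr ⟨_, _, hxy, by simp [hx], by simp, hq⟩))) hq'
        · exact absurd (Or.inr (Or.inl (Or.inr ⟨_, _, hxy, hx, hy, hq⟩))) hq'
  have hfin := spread hXc hW (by
    intro q hq hq0
    refine closure_outer hXc.isClosed hq fun hqX => ?_
    obtain ⟨r, hr, rfl⟩ := hXsub q hqX hq0
    exact hst hr hq)
  have hpW : D.arc h τ ∈ connectedComponentIn (Mu ∪ Mv)ᶜ (D.arc h τ) := by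
    apply mem_connectedComponentIn
    rintro (h1 | h1)
    · exact hnu τ hsτ h1
    · exact hnv τ hτt h1
  exact (hfin hpW).1 (harcX ⟨τ, rfl⟩)

lemma mem_walkSet {a b : V} {W : G.Walk a b} {q : ℝ × ℝ} (hq : q ∈ D.walkSet W) :
    (∃ w ∈ W.support, q = D.pos w) ∨ ∃ (x y : V) (h : G.Adj x y), s(x, y) ∈ W.edges ∧
      q ∈ D.arcSet h := by
  rcases hq with ⟨w, hw, rfl⟩ | hq
  · exact Or.inl ⟨w, hw, rfl⟩
  · simp only [mem_iUnion] at hq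
    obtain ⟨d, hd, hq⟩ := hq
    refine Or.inr ⟨d.fst, d.snd, d.adj, ?_, hq⟩
    exact List.mem_map.2 ⟨d, hd, rfl⟩

lemma walkSet_subset {a b : V} {W : G.Walk a b} {S : Set V} (h : ∀ x ∈ W.support, x ∈ S) :
    D.walkSet W ⊆ drawSet D S := by
  intro q hq
  rcases mem_walkSet D hq with ⟨w, hw, rfl⟩ | ⟨x, y, hxy, he, hq⟩
  · exact Or.inl ⟨w, h w hw, rfl⟩
  · exact Or.inr ⟨x, y, hxy, h _ (W.fst_mem_support_of_mem_edges he),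
      h _ (W.snd_mem_support_of_mem_edges he), hq⟩

lemma mem_support_of_pos {a b : V} {W : G.Walk a b} {w : V} (hq : D.pos w ∈ D.walkSet W) :
    w ∈ W.support := by
  rcases mem_walkSet D hq with ⟨x, hx, he⟩ | ⟨x, y, hxy, he, hq⟩
  · rwa [D.pos_inj he]
  · rcases arc_pos D hxy hq with rfl | rfl
    · exact W.fst_mem_support_of_mem_edges he
    · exact W.snd_mem_support_of_mem_edges he

lemma half_ne_pos {u v : V} (h : G.Adj u v) (w : V) :
    D.arc h ⟨1 / 2, by norm_num, by norm_num⟩ ≠ D.pos w := by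
  intro he
  rcases D.arc_vertex h _ w he with h | h
  · have := congrArg Subtype.val h
    norm_num at this
  · have := congrArg Subtype.val h
    norm_num at this

variable {D} in
lemma mem_edges_of_arc (hpl : D.IsPlane) {a b : V} {W : G.Walk a b} {u v : V} (h : G.Adj u v)
    (hq : D.arc h ⟨1 / 2, by norm_num, by norm_num⟩ ∈ D.walkSet W) : s(u, v) ∈ W.edges := by
  rcases mem_walkSet D hq with ⟨x, hx, he⟩ | ⟨x, y, hxy, he, hq⟩
  · exact absurd he (half_ne_pos D h x)
  · by_contra hcon
    obtain ⟨w, hw⟩ := arc_meet hpl h hxy (fun e => hcon (e ▸ he)) ⟨_, rfl⟩ hq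
    exact half_ne_pos D h w hw

variable {D} in
lemma edge_of_cover [Finite V] (hpl : D.IsPlane) {r : V} {F : G.Walk r r} (hF : D.BoundsOuter F)
    {S : Set V} (hS : ∀ x ∈ F.support, x ∈ S) {u v : V} (h : G.Adj u v)
    (hout : D.arcSet h ⊆ closure (outer (drawSet D S))) : s(u, v) ∈ F.edges := by
  have hF' : frontier (outer D.graphSet) = D.walkSet F := hF
  have hcomp : IsCompact D.graphSet := by rw [graphSet_eq]; exact drawSet_compact D _
  have hsub : outer (drawSet D S) ⊆ outer D.graphSet := by
    rintro q ⟨hq, hb⟩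
    refine spread hcomp hb ?_ (mem_connectedComponentIn hq)
    intro x hx hx0
    by_contra hxo
    apply hx0
    apply walkSet_subset D hS
    rw [← hF']
    exact ⟨hx, fun hi => hxo (interior_subset hi)⟩
  apply mem_edges_of_arc hpl h
  rw [← hF']
  apply mem_frontier_outer
  · rw [graphSet_eq]
    exact Or.inr ⟨u, v, h, trivial, trivial, _, rfl⟩
  · exact closure_mono hsub (hout ⟨_, rfl⟩)

end Draw

end NC
namespace NC

section Sub

variable {V W : Type} {G : SimpleGraph V}

/-- The restriction of a drawing to an induced subgraph. -/
def comapDrawing (D : Drawing G) (φ : W → V) (hφ : Function.Injective φ) :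
    Drawing (G.comap φ) where
  pos w := D.pos (φ w)
  pos_inj := D.pos_inj.comp hφ
  arc u v h := D.arc (u := φ u) (v := φ v) h
  arc_symm u v h := D.arc_symm (u := φ u) (v := φ v) h
  arc_inj u v h := D.arc_inj (u := φ u) (v := φ v) h
  arc_vertex u v h t w := D.arc_vertex (u := φ u) (v := φ v) h t (φ w)
  arc_meet_once u v x y h₁ h₂ hne := D.arc_meet_once (u := φ u) (v := φ v) (x := φ x) (y := φ y)
    h₁ h₂ (fun e => hne (Sym2.map.injective hφ e))
  arc_no_triple u₁ v₁ u₂ v₂ u₃ v₃ h₁ h₂ h₃ n1 n2 n3 p hp := by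
    obtain ⟨w, rfl⟩ := D.arc_no_triple (u₁ := φ u₁) (v₁ := φ v₁) (u₂ := φ u₂) (v₂ := φ v₂)
      (u₃ := φ u₃) (v₃ := φ v₃) h₁ h₂ h₃ (fun e => n1 (Sym2.map.injective hφ e))
      (fun e => n2 (Sym2.map.injective hφ e)) (fun e => n3 (Sym2.map.injective hφ e)) p hp
    rcases arc_pos D (u := φ u₁) (v := φ v₁) h₁ hp.1.1 with h | h
    · exact ⟨u₁, by rw [h]⟩
    · exact ⟨v₁, by rw [h]⟩

lemma comap_plane {D : Drawing G} (hD : D.IsPlane) (φ : W → V) (hφ : Function.Injective φ) :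
    (comapDrawing D φ hφ).IsPlane := by
  rintro p ⟨u, v, x, y, h₁, h₂, hne, hp1, hp2⟩
  exact hD p ⟨φ u, φ v, φ x, φ y, h₁, h₂, fun e => hne (Sym2.map.injective hφ e), hp1, hp2⟩

lemma comap_graphSet (D : Drawing G) (φ : W → V) (hφ : Function.Injective φ) :
    (comapDrawing D φ hφ).graphSet = drawSet D (range φ) := by
  rw [graphSet_eq]
  ext q
  constructor
  · rintro (⟨w, -, rfl⟩ | ⟨x, y, h, -, -, hq⟩)
    · exact Or.inl ⟨φ w, ⟨w, rfl⟩, rfl⟩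
    · exact Or.inr ⟨φ x, φ y, h, ⟨x, rfl⟩, ⟨y, rfl⟩, hq⟩
  · rintro (⟨_, ⟨w, rfl⟩, rfl⟩ | ⟨_, _, h, ⟨x, rfl⟩, ⟨y, rfl⟩, hq⟩)
    · exact Or.inl ⟨w, trivial, rfl⟩
    · exact Or.inr ⟨x, y, h, trivial, trivial, hq⟩

lemma exists_lift (φ : W → V) {a b : V} (Q : G.Walk a b) (hQ : ∀ x ∈ Q.support, x ∈ range φ) :
    ∀ a', φ a' = a → ∃ (b' : W) (Q' : (G.comap φ).Walk a' b'),
      Q'.support.map φ = Q.support ∧ Q'.edges.map (Sym2.map φ) = Q.edges := by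
  induction Q with
  | nil => 
    rintro a' rfl
    exact ⟨a', SimpleGraph.Walk.nil, by simp, by simp⟩
  | @cons u v w h Q ih =>
    rintro a' rfl
    obtain ⟨v', rfl⟩ := hQ v (by simp)
    obtain ⟨b', Q', h1, h2⟩ := ih (fun x hx => hQ x (by simp [hx])) v' rfl
    have hadj : (G.comap φ).Adj a' v' := h
    exact ⟨b', SimpleGraph.Walk.cons hadj Q', by simp [h1], by simp [h2]⟩

end Sub

/-- Every proper induced subgraph of a minimal counterexample satisfying the hypotheses of the
theorem is colorable. -/
lemma sub_color (C : Config) (hmin : C.Minimal) (S : Set (Fin C.n)) (hS : S ≠ univ)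
    {a b : Fin C.n} (Q : C.G.Walk a b) (hQ : Q.IsPath) (hl : Q.length ≤ 2)
    (hQS : ∀ x ∈ Q.support, x ∈ S)
    (hpos : ∀ x ∈ Q.support, C.D.pos x ∈ closure (outer (drawSet C.D S)))
    (harc : ∀ x y (h : C.G.Adj x y), s(x, y) ∈ Q.edges →
      C.D.arcSet h ⊆ closure (outer (drawSet C.D S)))
    (L' : Fin C.n → Finset ℕ)
    (hL : ∀ v ∈ S, v ∉ Q.support → L' v = C.L v ∧ v ∉ C.P.support)
    (h1 : ∀ v ∈ Q.support, (L' v).card = 1)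
    (hprop : ∀ u ∈ Q.support, ∀ v ∈ Q.support, C.G.Adj u v → L' u ≠ L' v)
    (hcn : ∀ p₀ p₁ p₂, Q.support = [p₀, p₁, p₂] → ∀ x ∈ S, C.G.Adj x p₀ → C.G.Adj x p₁ →
      C.G.Adj x p₂ → L' x ≠ L' p₀ ∪ L' p₁ ∪ L' p₂) :
    ∃ c : Fin C.n → ℕ, (∀ v ∈ S, c v ∈ L' v) ∧
      ∀ u ∈ S, ∀ v ∈ S, C.G.Adj u v → c u ≠ c v := by
  classical
  by_contra hcon
  let m := Nat.card S
  let σ : Fin m ≃ S := (Finite.equivFin S).symm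
  let φ : Fin m → Fin C.n := fun i => (σ i : Fin C.n)
  have hφ : Function.Injective φ := Subtype.val_injective.comp σ.injective
  have hrange : range φ = S := by
    ext x
    constructor
    · rintro ⟨i, rfl⟩; exact (σ i).2
    · intro hx; exact ⟨σ.symm ⟨x, hx⟩, by simp [φ]⟩
  have hφS : ∀ i, φ i ∈ S := fun i => (σ i).2
  obtain ⟨a', ha'⟩ : a ∈ range φ := hrange ▸ hQS a Q.start_mem_support
  obtain ⟨b', Q', hs, he⟩ := exists_lift φ Q (fun x hx => hrange ▸ hQS x hx) a' ha'
  have hmem : ∀ i, i ∈ Q'.support ↔ φ i ∈ Q.support := by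
    intro i
    rw [← hs, List.mem_map_of_injective hφ]
  have hgs : (comapDrawing C.D φ hφ).graphSet = drawSet C.D S := by
    rw [comap_graphSet, hrange]
  have hof : (comapDrawing C.D φ hφ).outerFace = outer (drawSet C.D S) := by
    rw [← hgs]; rfl
  have honout : ∀ x ∈ S, C.D.pos x ∈ closure (outer (drawSet C.D S)) →
      C.D.pos x ∈ frontier (outer (drawSet C.D S)) := fun x hx h =>
    mem_frontier_outer ((pos_mem_drawSet C.D).2 hx) h
  have hout : ∀ i, ¬ (comapDrawing C.D φ hφ).OnOuter i → ¬ C.D.OnOuter (φ i) := by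
    intro i hi ho
    apply hi
    show C.D.pos (φ i) ∈ frontier _
    rw [hof]
    refine frontier_outer_mono (Y := C.D.graphSet) ?_ ((pos_mem_drawSet C.D).2 (hφS i)) ho
    rw [graphSet_eq]
    exact drawSet_mono _ (subset_univ _)
  have hge3 : ∀ v ∈ S, v ∉ Q.support → 3 ≤ (L' v).card := by
    intro v hv hvQ
    obtain ⟨e, hP⟩ := hL v hv hvQ
    rw [e]
    by_cases ho : C.D.OnOuter v
    · exact C.size3 v ho hP
    · have := C.size5 v ho; omega
  let C' : Config :=
    { n := m
      G := C.G.comap φ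
      D := comapDrawing C.D φ hφ
      plane := comap_plane C.plane φ hφ
      a := a'
      b := b'
      P := Q'
      P_path := by
        have := hQ.support_nodup
        rw [← hs] at this
        exact SimpleGraph.Walk.IsPath.mk' (List.Nodup.of_map _ this)
      P_len := by
        have h := congrArg List.length hs
        simp only [List.length_map, SimpleGraph.Walk.length_support] at h
        omega
      P_boundary := by
        rw [hof]
        intro q hq
        rcases mem_walkSet _ hq with ⟨w, hw, rfl⟩ | ⟨x, y, hxy, hxye, hq⟩
        · exact honout _ (hφS w) (hpos _ ((hmem w).1 hw))
        · refine mem_frontier_outer ?_ (harc (φ x) (φ y) hxy ?_ hq)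
          · exact Or.inr ⟨φ x, φ y, hxy, hφS x, hφS y, hq⟩
          · rw [← he]
            exact List.mem_map.2 ⟨_, hxye, rfl⟩
      L := fun i => L' (φ i)
      size5 := by
        intro i hi
        have hiQ : φ i ∉ Q.support := by
          intro h
          apply hi
          show C.D.pos (φ i) ∈ frontier _
          rw [hof]
          exact honout _ (hφS i) (hpos _ h)
        rw [(hL _ (hφS i) hiQ).1]
        exact C.size5 _ (hout i hi)
      size3 := by
        intro i _ hi
        exact hge3 _ (hφS i) (fun h => hi ((hmem i).2 h))
      size1 := by
        intro i hi
        exact h1 _ ((hmem i).1 hi)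
      no_adjacent_3 := by
        intro i j hij h3 h3'
        have hi : φ i ∉ Q.support := fun h => by have := h1 _ h; omega
        have hj : φ j ∉ Q.support := fun h => by have := h1 _ h; omega
        rw [(hL _ (hφS i) hi).1] at h3
        rw [(hL _ (hφS j) hj).1] at h3'
        exact C.no_adjacent_3 _ _ hij h3 h3'
      proper_on_P := by
        intro i hi j hj hij
        exact hprop _ ((hmem i).1 hi) _ ((hmem j).1 hj) hij
      common_neighbor := by
        intro p₀ p₁ p₂ hp x h0 h1 h2
        refine hcn (φ p₀) (φ p₁) (φ p₂) ?_ (φ x) (hφS x) h0 h1 h2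
        rw [← hs, hp]
        rfl
      not_colorable := by
        rintro ⟨c, hc1, hc2⟩
        apply hcon
        refine ⟨fun v => if h : v ∈ S then c (σ.symm ⟨v, h⟩) else 0, ?_, ?_⟩
        · intro v hv
          have := hc1 (σ.symm ⟨v, hv⟩)
          simpa [hv, φ] using this
        · intro u hu v hv huv
          have := hc2 (u := σ.symm ⟨u, hu⟩) (v := σ.symm ⟨v, hv⟩) (by simpa [φ] using huv)
          simpa [hu, hv] using this }
  have hsz := hmin.1 C'
  have hm : m < C.n := by
    have h : S.ncard < (univ : Set (Fin C.n)).ncard :=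
      Set.ncard_lt_ncard (Set.ssubset_univ_iff.2 hS)
    rw [Set.ncard_univ, Nat.card_eq_fintype_card, Fintype.card_fin] at h
    exact h
  have hedge : (C.G.comap φ).edgeSet.ncard ≤ C.G.edgeSet.ncard := by
    refine Set.ncard_le_ncard_of_injOn (Sym2.map φ) ?_ (Sym2.map.injective hφ).injOn
      (Set.toFinite _)
    intro e
    induction e with
    | h x y => intro h; exact h
  have : C.n + C.G.edgeSet.ncard ≤ m + (C.G.comap φ).edgeSet.ncard := hsz
  omega

end NC
namespace NC

section Comp

variable {V : Type} (G : SimpleGraph V)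

/-- The graph with the vertices `u`, `v` isolated. -/
def delG (u v : V) : SimpleGraph V :=
  SimpleGraph.fromRel fun x y => G.Adj x y ∧ (x ≠ u ∧ x ≠ v) ∧ (y ≠ u ∧ y ≠ v)

lemma delG_adj {u v x y : V} :
    (delG G u v).Adj x y ↔ G.Adj x y ∧ (x ≠ u ∧ x ≠ v) ∧ (y ≠ u ∧ y ≠ v) := by
  simp only [delG, SimpleGraph.fromRel_adj]
  constructor
  · rintro ⟨-, h | ⟨h, a, b⟩⟩
    · exact h
    · exact ⟨h.symm, b, a⟩
  · intro h
    exact ⟨h.1.ne, Or.inl h⟩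

/-- The component of `w` after deleting `u` and `v`. -/
def comp (u v w : V) : Set V := {x | (delG G u v).Reachable w x}

lemma self_mem_comp (u v w : V) : w ∈ comp G u v w := SimpleGraph.Reachable.refl _

variable {G}

lemma comp_symm {u v w x : V} (h : x ∈ comp G u v w) : w ∈ comp G u v x :=
  SimpleGraph.Reachable.symm h

lemma comp_trans {u v w x y : V} (h : x ∈ comp G u v w) (h' : y ∈ comp G u v x) :
    y ∈ comp G u v w :=
  SimpleGraph.Reachable.trans h h'

lemma comp_eq {u v w x : V} (h : x ∈ comp G u v w) : comp G u v x = comp G u v w := by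
  ext y
  exact ⟨fun h' => comp_trans h h', fun h' => comp_trans (comp_symm h) h'⟩

lemma comp_comm (u v w : V) : comp G u v w = comp G v u w := by
  have : delG G u v = delG G v u := by
    ext x y
    rw [delG_adj, delG_adj]
    tauto
  simp only [comp, this]

lemma adj_mem_comp {u v x y : V} (h : G.Adj x y) (h1 : x ≠ u) (h2 : x ≠ v) (h3 : y ≠ u)
    (h4 : y ≠ v) : y ∈ comp G u v x :=
  SimpleGraph.Adj.reachable ((delG_adj G).2 ⟨h, ⟨h1, h2⟩, h3, h4⟩)

lemma comp_ne {u v w x : V} (hu : w ≠ u) (hv : w ≠ v) (hx : x ∈ comp G u v w) :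
    x ≠ u ∧ x ≠ v := by
  obtain ⟨p⟩ := comp_symm hx
  cases p with
  | nil => exact ⟨hu, hv⟩
  | cons h p => exact ((delG_adj G).1 h).2.1

lemma comp_of_walk {u v a b : V} (p : G.Walk a b) (hu : u ∉ p.support) (hv : v ∉ p.support) :
    b ∈ comp G u v a := by
  induction p with
  | nil => exact self_mem_comp _ _ _ _
  | @cons x y z h p ih =>
    simp only [SimpleGraph.Walk.support_cons, List.mem_cons, not_or] at hu hv
    refine comp_trans (adj_mem_comp h (Ne.symm hu.1) (Ne.symm hv.1) ?_ ?_) (ih hu.2 hv.2)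
    · rintro rfl; exact hu.2 p.start_mem_support
    · rintro rfl; exact hv.2 p.start_mem_support

lemma comp_preconnected (D : Drawing G) (u v w : V) :
    IsPreconnected (drawSet D (comp G u v w)) := by
  have key : ∀ x, x ∈ comp G u v w → ∃ t ⊆ drawSet D (comp G u v w),
      D.pos w ∈ t ∧ D.pos x ∈ t ∧ IsPreconnected t := by
    rintro x ⟨p₀⟩
    suffices H : ∀ a, a ∈ comp G u v w → ∀ (p : (delG G u v).Walk a x),
        ∃ t ⊆ drawSet D (comp G u v w), D.pos a ∈ t ∧ D.pos x ∈ t ∧ IsPreconnected t from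
      H w (self_mem_comp _ _ _ _) p₀
    clear p₀
    intro a ha p
    induction p with
    | @nil a => exact ⟨{D.pos a}, by
        rintro _ rfl; exact (pos_mem_drawSet D).2 ha, rfl, rfl, isPreconnected_singleton⟩
    | @cons a b x h p ih =>
      have hb : b ∈ comp G u v w := comp_trans ha (SimpleGraph.Adj.reachable h)
      obtain ⟨t, ht, h1, h2, h3⟩ := ih hb
      have hab := ((delG_adj G).1 h).1
      refine ⟨D.arcSet hab ∪ t, union_subset ?_ ht, Or.inl (pos_left_mem D hab), Or.inr h2, ?_⟩
      · intro q hq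
        exact Or.inr ⟨a, b, hab, ha, hb, hq⟩
      · exact IsPreconnected.union (D.pos b) (pos_right_mem D hab) h1
          (isPreconnected_range (D.arc hab).continuous) h3
  refine isPreconnected_of_forall (D.pos w) ?_
  rintro q (⟨x, hx, rfl⟩ | ⟨x, y, h, hx, hy, hq⟩)
  · exact key x hx
  · obtain ⟨t, ht, h1, h2, h3⟩ := key x hx
    refine ⟨D.arcSet h ∪ t, union_subset ?_ ht, Or.inr h1, Or.inl hq, ?_⟩
    · intro q hq
      exact Or.inr ⟨x, y, h, hx, hy, hq⟩
    · exact IsPreconnected.union (D.pos x) (pos_left_mem D h) h2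
        (isPreconnected_range (D.arc h).continuous) h3

/-- The side of the component of `w`: the component together with `u` and `v`. -/
def side (G : SimpleGraph V) (u v w : V) : Set V := insert u (insert v (comp G u v w))

lemma mem_side {u v w x : V} : x ∈ side G u v w ↔ x = u ∨ x = v ∨ x ∈ comp G u v w := Iff.rfl

lemma glue {L : V → Finset ℕ} {u v : V} {α β : ℕ} (hα : α ∈ L u) (hβ : β ∈ L v)
    (hne : α ≠ β)
    (h : ∀ w, w ≠ u → w ≠ v → ∃ c : V → ℕ, c u = α ∧ c v = β ∧ (∀ x ∈ comp G u v w, c x ∈ L x) ∧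
      ∀ x ∈ side G u v w, ∀ y ∈ side G u v w, G.Adj x y → c x ≠ c y) :
    u ≠ v → ListColorable G L := by
  classical
  intro huv
  have h' : ∀ K : Set V, ∃ c : V → ℕ, (∃ w, w ≠ u ∧ w ≠ v ∧ K = comp G u v w) →
      c u = α ∧ c v = β ∧ (∀ x ∈ K, c x ∈ L x) ∧
      ∀ x ∈ insert u (insert v K), ∀ y ∈ insert u (insert v K), G.Adj x y → c x ≠ c y := by
    intro K
    by_cases hK : ∃ w, w ≠ u ∧ w ≠ v ∧ K = comp G u v w
    · obtain ⟨w, h1, h2, rfl⟩ := hK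
      obtain ⟨c, hc⟩ := h w h1 h2
      exact ⟨c, fun _ => hc⟩
    · exact ⟨fun _ => 0, fun h => absurd h hK⟩
  choose col hcol using h'
  let c : V → ℕ := fun x => if x = u then α else if x = v then β else col (comp G u v x) x
  have hc : ∀ w, w ≠ u → w ≠ v → ∀ x ∈ side G u v w, c x = col (comp G u v w) x := by
    intro w h1 h2 x hx
    obtain ⟨e1, e2, -⟩ := hcol (comp G u v w) ⟨w, h1, h2, rfl⟩
    rcases hx with rfl | rfl | hx
    · simp [c, e1]
    · simp [c, e2, huv.symm]
    · obtain ⟨h3, h4⟩ := comp_ne h1 h2 hx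
      simp [c, h3, h4, comp_eq hx]
  have main : ∀ x y, G.Adj x y → x ≠ u → x ≠ v → c x ≠ c y := by
    intro x y hxy h1 h2
    have hx : x ∈ side G u v x := Or.inr (Or.inr (self_mem_comp _ _ _ _))
    have hy : y ∈ side G u v x := by
      by_cases h3 : y = u
      · exact Or.inl h3
      by_cases h4 : y = v
      · exact Or.inr (Or.inl h4)
      exact Or.inr (Or.inr (adj_mem_comp hxy h1 h2 h3 h4))
    rw [hc x h1 h2 x hx, hc x h1 h2 y hy]
    exact (hcol (comp G u v x) ⟨x, h1, h2, rfl⟩).2.2.2 x hx y hy hxy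
  refine ⟨c, ?_, ?_⟩
  · intro x
    by_cases h1 : x = u
    · subst h1; simpa [c] using hα
    by_cases h2 : x = v
    · subst h2; simpa [c, h1] using hβ
    have := (hcol (comp G u v x) ⟨x, h1, h2, rfl⟩).2.2.1 x (self_mem_comp _ _ _ _)
    simpa [c, h1, h2] using this
  · intro x y hxy
    by_cases hx : x ≠ u ∧ x ≠ v
    · exact main x y hxy hx.1 hx.2
    by_cases hy : y ≠ u ∧ y ≠ v
    · exact (main y x hxy.symm hy.1 hy.2).symm
    have hx' : x = u ∨ x = v := by tauto
    have hy' : y = u ∨ y = v := by tauto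
    have cu : c u = α := by simp [c]
    have cv : c v = β := by simp [c, huv.symm]
    rcases hx' with rfl | rfl <;> rcases hy' with rfl | rfl
    · exact absurd hxy (G.irrefl)
    · rw [cu, cv]; exact hne
    · rw [cu, cv]; exact hne.symm
    · exact absurd hxy (G.irrefl)

lemma path_split [DecidableEq V] {a b : V} {W : G.Walk a b} (hW : W.IsPath) {f x : V} (hf : f ∈ W.support)
    (hx : x ≠ f) : x ∉ (W.takeUntil f hf).support ∨ x ∉ (W.dropUntil f hf).support := by
  by_contra hcon
  push Not at hcon
  obtain ⟨h1, h2⟩ := hcon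
  have hn := hW.support_nodup
  rw [← W.take_spec hf, SimpleGraph.Walk.support_append] at hn
  rw [← SimpleGraph.Walk.cons_tail_support, List.mem_cons] at h2
  rcases h2 with h2 | h2
  · exact hx h2
  · exact (List.nodup_append.1 hn).2.2 x h1 x h2 rfl

/-- Opening a cycle at a vertex. -/
lemma open_cycle {r p₀ p₁ p₂ : V} {F : G.Walk r r} (hF : F.IsCycle) (h01 : s(p₀, p₁) ∈ F.edges)
    (h12 : s(p₁, p₂) ∈ F.edges) (hne : p₀ ≠ p₂) :
    ∃ W : G.Walk p₀ p₂, W.IsPath ∧ p₁ ∉ W.support ∧ (∀ f ∈ F.support, f = p₁ ∨ f ∈ W.support) ∧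
      ∀ x, s(p₁, x) ∈ F.edges → x = p₀ ∨ x = p₂ := by
  classical
  have hp1 : p₁ ∈ F.support := F.fst_mem_support_of_mem_edges h12
  have hc := hF.rotate hp1
  have hs : ∀ f, f ∈ F.support → f ∈ (F.rotate p₁ hp1).support := fun f hf => by
    rw [SimpleGraph.Walk.mem_support_rotate_iff]; exact hf
  have he : ∀ e, e ∈ F.edges → e ∈ (F.rotate p₁ hp1).edges := fun e h =>
    (F.rotate_edges p₁ hp1).mem_iff.2 h
  generalize F.rotate p₁ hp1 = F' at hc hs he
  cases F' with
  | nil => exact absurd rfl hc.ne_nil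
  | @cons _ x _ h q =>
    rw [SimpleGraph.Walk.cons_isCycle_iff] at hc
    obtain ⟨hq, -⟩ := hc
    have hs' : ∀ f, f ∈ F.support → f = p₁ ∨ f ∈ q.reverse.support := fun f hf => by
      have := hs f hf
      simpa using this
    have he' : ∀ e, e ∈ F.edges → e = s(p₁, x) ∨ e ∈ q.reverse.edges := fun f hf => by
      have := he f hf
      simpa using this
    have hq' := hq.reverse
    generalize q.reverse = R at hs' he' hq'
    cases R with
    | nil => exact absurd h (G.irrefl)
    | @cons _ z _ h' R =>
      rw [SimpleGraph.Walk.cons_isPath_iff] at hq'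
      have hnb : ∀ w, s(p₁, w) ∈ F.edges → w = x ∨ w = z := by
        intro w hw
        rcases he' _ hw with h1 | h1
        · exact Or.inl (Sym2.congr_right.1 h1)
        · rw [SimpleGraph.Walk.edges_cons, List.mem_cons] at h1
          rcases h1 with h1 | h1
          · exact Or.inr (Sym2.congr_right.1 h1)
          · exact absurd (R.fst_mem_support_of_mem_edges h1) hq'.2
      have hcov : ∀ f ∈ F.support, f = p₁ ∨ f ∈ R.support := by
        intro f hf
        have := hs' f hf
        simp only [SimpleGraph.Walk.support_cons, List.mem_cons] at this
        tauto
      have h0 := hnb p₀ (by rwa [Sym2.eq_swap])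
      have h2 := hnb p₂ h12
      rcases h0 with rfl | rfl <;> rcases h2 with rfl | rfl
      · exact absurd rfl hne
      · exact ⟨R.reverse, hq'.1.reverse, by simpa using hq'.2, by simpa using hcov, hnb⟩
      · exact ⟨R, hq'.1, hq'.2, hcov, fun w hw => (hnb w hw).symm⟩
      · exact absurd rfl hne

end Comp

end NC
namespace NC

section Chord

variable {C : Config} {r : Fin C.n} {F : C.G.Walk r r}

lemma drawSet_sub_graphSet (C : Config) (S : Set (Fin C.n)) : drawSet C.D S ⊆ C.D.graphSet := by
  rw [graphSet_eq]
  exact drawSet_mono _ (subset_univ _)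

lemma bd_mono (C : Config) (S : Set (Fin C.n)) :
    frontier C.D.outerFace ⊆ closure (outer (drawSet C.D S)) := fun q hq =>
  closure_mono (outer_mono (drawSet_sub_graphSet C S)) (show q ∈ closure (outer C.D.graphSet) from
    frontier_subset_closure hq)

lemma pos_walkSet {V : Type} {G : SimpleGraph V} (D : Drawing G) {a b : V} {W : G.Walk a b} {x : V}
    (hx : x ∈ W.support) : D.pos x ∈ D.walkSet W :=
  Or.inl ⟨x, hx, rfl⟩

lemma arc_walkSet {V : Type} {G : SimpleGraph V} (D : Drawing G) {a b : V} {W : G.Walk a b} {x y : V}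
    (h : G.Adj x y) (hx : s(x, y) ∈ W.edges) : D.arcSet h ⊆ D.walkSet W := by
  intro q hq
  obtain ⟨d, hd, he⟩ := List.mem_map.1 hx
  refine Or.inr ?_
  simp only [mem_iUnion]
  refine ⟨d, hd, ?_⟩
  obtain ⟨⟨d1, d2⟩, hadj⟩ := d
  have he' : s(d1, d2) = s(x, y) := he
  rw [Sym2.eq_iff] at he'
  rcases he' with ⟨rfl, rfl⟩ | ⟨rfl, rfl⟩
  · exact hq
  · have := arcSet_symm D h
    exact this ▸ hq

lemma F_pos (hF : C.D.BoundsOuter F) (S : Set (Fin C.n)) {x : Fin C.n} (hx : x ∈ F.support) :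
    C.D.pos x ∈ closure (outer (drawSet C.D S)) :=
  bd_mono C S (by rw [show frontier C.D.outerFace = C.D.walkSet F from hF]; exact pos_walkSet _ hx)

lemma F_arc (hF : C.D.BoundsOuter F) (S : Set (Fin C.n)) {x y : Fin C.n} (h : C.G.Adj x y)
    (hx : s(x, y) ∈ F.edges) : C.D.arcSet h ⊆ closure (outer (drawSet C.D S)) := fun q hq =>
  bd_mono C S (by
    rw [show frontier C.D.outerFace = C.D.walkSet F from hF]; exact arc_walkSet _ h hx hq)

lemma onOuter_F (hF : C.D.BoundsOuter F) {x : Fin C.n} : C.D.OnOuter x ↔ x ∈ F.support := by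
  unfold Drawing.OnOuter
  rw [show frontier C.D.outerFace = C.D.walkSet F from hF]
  exact ⟨mem_support_of_pos _, pos_walkSet _⟩

lemma chord_arc (hF : C.D.BoundsOuter F) {u v w : Fin C.n} (h : C.G.Adj u v) (hu : u ∈ F.support)
    (hv : v ∈ F.support) (hwu : w ≠ u) (hwv : w ≠ v) :
    C.D.arcSet h ⊆ closure (outer (drawSet C.D (side C.G u v w))) := by
  have hp : ∀ x ∈ F.support, C.D.pos x ∈ closure (outer C.D.graphSet) := by
    intro x hx
    rw [graphSet_eq]
    exact F_pos hF _ hx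
  exact edge_outer C.plane h (fun h => (comp_ne hwu hwv h).1 rfl) (fun h => (comp_ne hwu hwv h).2 rfl)
    (comp_preconnected _ _ _ _) (drawSet_sub_graphSet C _) (hp u hu) (hp v hv)

lemma chord_cover (hF : C.D.BoundsOuter F) {u v w : Fin C.n} (h : C.G.Adj u v) (hu : u ∈ F.support)
    (hv : v ∈ F.support) (huv : s(u, v) ∉ F.edges) (hwu : w ≠ u) (hwv : w ≠ v) :
    ¬ ∀ x ∈ F.support, x ∈ side C.G u v w := fun hc =>
  huv (edge_of_cover C.plane hF hc h (chord_arc hF h hu hv hwu hwv))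

lemma side_ne_univ (hF : C.D.BoundsOuter F) {u v w : Fin C.n} (h : C.G.Adj u v) (hu : u ∈ F.support)
    (hv : v ∈ F.support) (huv : s(u, v) ∉ F.edges) (hwu : w ≠ u) (hwv : w ≠ v) :
    side C.G u v w ≠ univ := fun e =>
  chord_cover hF h hu hv huv hwu hwv (fun x _ => e ▸ mem_univ x)

/-- Components that do not meet the precolored path can be colored after precoloring the chord. -/
lemma other_comp (hmin : C.Minimal) (hF : C.D.BoundsOuter F) {u v w : Fin C.n} (h : C.G.Adj u v)
    (hu : u ∈ F.support) (hv : v ∈ F.support) (huv : s(u, v) ∉ F.edges) (hwu : w ≠ u) (hwv : w ≠ v)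
    (hP : ∀ x ∈ comp C.G u v w, x ∉ C.P.support) {α β : ℕ} (hne : α ≠ β) :
    ∃ c : Fin C.n → ℕ, c u = α ∧ c v = β ∧ (∀ x ∈ comp C.G u v w, c x ∈ C.L x) ∧
      ∀ x ∈ side C.G u v w, ∀ y ∈ side C.G u v w, C.G.Adj x y → c x ≠ c y := by
  classical
  have hvu : v ≠ u := h.ne'
  obtain ⟨c, hc1, hc2⟩ := sub_color C hmin (side C.G u v w) (side_ne_univ hF h hu hv huv hwu hwv)
    (SimpleGraph.Walk.cons h SimpleGraph.Walk.nil) (by simp [h.ne]) (by simp)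
    (by
      intro x hx
      simp only [SimpleGraph.Walk.support_cons, SimpleGraph.Walk.support_nil, List.mem_cons,
        List.not_mem_nil, or_false] at hx
      rcases hx with rfl | rfl
      · exact Or.inl rfl
      · exact Or.inr (Or.inl rfl))
    (by
      intro x hx
      simp only [SimpleGraph.Walk.support_cons, SimpleGraph.Walk.support_nil, List.mem_cons,
        List.not_mem_nil, or_false] at hx
      rcases hx with rfl | rfl
      · exact F_pos hF _ hu
      · exact F_pos hF _ hv)
    (by
      intro x y hxy he
      simp only [SimpleGraph.Walk.edges_cons, SimpleGraph.Walk.edges_nil, List.mem_cons,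
        List.not_mem_nil, or_false, Sym2.eq_iff] at he
      rcases he with ⟨rfl, rfl⟩ | ⟨rfl, rfl⟩
      · exact chord_arc hF h hu hv hwu hwv
      · rw [arcSet_symm C.D h]
        exact chord_arc hF h hu hv hwu hwv)
    (fun x => if x = u then {α} else if x = v then {β} else C.L x)
    (by
      intro x hx hxQ
      simp only [SimpleGraph.Walk.support_cons, SimpleGraph.Walk.support_nil, List.mem_cons,
        List.not_mem_nil, or_false, not_or] at hxQ
      refine ⟨by simp [hxQ.1, hxQ.2], hP x ?_⟩
      rcases hx with h1 | h1 | h1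
      · exact absurd h1 hxQ.1
      · exact absurd h1 hxQ.2
      · exact h1)
    (by
      intro x hx
      simp only [SimpleGraph.Walk.support_cons, SimpleGraph.Walk.support_nil, List.mem_cons,
        List.not_mem_nil, or_false] at hx
      rcases hx with rfl | rfl
      · simp
      · simp [hvu])
    (by
      intro x hx y hy hxy
      simp only [SimpleGraph.Walk.support_cons, SimpleGraph.Walk.support_nil, List.mem_cons,
        List.not_mem_nil, or_false] at hx hy
      rcases hx with rfl | rfl <;> rcases hy with rfl | rfl
      · exact absurd hxy (C.G.irrefl)
      · simp [hvu, hne]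
      · simp [hvu, hne.symm]
      · exact absurd hxy (C.G.irrefl))
    (by
      intro p₀ p₁ p₂ hs
      simp at hs)
  refine ⟨c, ?_, ?_, ?_, hc2⟩
  · simpa using hc1 u (Or.inl rfl)
  · simpa [hvu] using hc1 v (Or.inr (Or.inl rfl))
  · intro x hx
    have := hc1 x (Or.inr (Or.inr hx))
    obtain ⟨h1, h2⟩ := comp_ne hwu hwv hx
    simpa [h1, h2] using this

/-- If the precolored path is on one side of the chord, the graph is colorable. -/
lemma case_one (hmin : C.Minimal) (hF : C.D.BoundsOuter F) {u v w : Fin C.n} (h : C.G.Adj u v)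
    (hu : u ∈ F.support) (hv : v ∈ F.support) (huv : s(u, v) ∉ F.edges) (hwu : w ≠ u) (hwv : w ≠ v)
    (hP : ∀ x ∈ C.P.support, x ∈ side C.G u v w) : False := by
  obtain ⟨c, hc1, hc2⟩ := sub_color C hmin (side C.G u v w) (side_ne_univ hF h hu hv huv hwu hwv)
    C.P C.P_path C.P_len hP
    (fun x hx => bd_mono C _ (C.P_boundary (pos_walkSet _ hx)))
    (fun x y h he q hq => bd_mono C _ (C.P_boundary (arc_walkSet _ h he hq)))
    C.L (fun v _ hv => ⟨rfl, hv⟩) C.size1 C.proper_on_P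
    (fun p₀ p₁ p₂ hs x _ => C.common_neighbor p₀ p₁ p₂ hs x)
  have hus : u ∈ side C.G u v w := Or.inl rfl
  have hvs : v ∈ side C.G u v w := Or.inr (Or.inl rfl)
  have hne := hc2 u hus v hvs h
  refine C.not_colorable (glue (hc1 u hus) (hc1 v hvs) hne (fun w' h1 h2 => ?_) h.ne)
  by_cases hw : w' ∈ comp C.G u v w
  · refine ⟨c, rfl, rfl, ?_, ?_⟩
    · rw [comp_eq hw]
      exact fun x hx => hc1 x (Or.inr (Or.inr hx))
    · unfold side
      rw [comp_eq hw]
      exact hc2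
  · refine other_comp hmin hF h hu hv huv h1 h2 (fun x hx hxP => hw ?_) hne
    obtain ⟨h3, h4⟩ := comp_ne h1 h2 hx
    rcases hP x hxP with h5 | h5 | h5
    · exact absurd h5 h3
    · exact absurd h5 h4
    · exact comp_trans h5 (comp_symm hx)

end Chord

end NC
namespace NC

section CaseTwo

variable {C : Config} {r : Fin C.n} {F : C.G.Walk r r}

/-- A color of `y` which is forbidden because of the side of `p₀`. -/
def Bad (C : Config) (p₀ p₁ y : Fin C.n) (c : ℕ) : Prop :=
  (C.G.Adj y p₀ ∧ c ∈ C.L p₀) ∨ ∃ x ∈ comp C.G p₁ y p₀, C.G.Adj x p₀ ∧ C.G.Adj x p₁ ∧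
    C.G.Adj x y ∧ C.L x = C.L p₀ ∪ C.L p₁ ∪ {c}

/-- Chords at the middle vertex of the path separate its ends. -/
lemma sep_two (hFc : F.IsCycle) (hF : C.D.BoundsOuter F) {p₀ p₁ p₂ x : Fin C.n}
    (h01 : s(p₀, p₁) ∈ F.edges) (h12 : s(p₁, p₂) ∈ F.edges) (h02 : p₀ ≠ p₂)
    (h : C.G.Adj p₁ x) (hx : x ∈ F.support) (hx0 : x ≠ p₀) (hx2 : x ≠ p₂) :
    p₂ ∉ comp C.G p₁ x p₀ := by
  classical
  intro hcon
  obtain ⟨W, hW, hp1, hcov, hnb⟩ := open_cycle hFc h01 h12 h02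
  have hp1F : p₁ ∈ F.support := F.fst_mem_support_of_mem_edges h12
  have h01' : p₀ ≠ p₁ := by rintro rfl; exact hp1 W.start_mem_support
  refine chord_cover (w := p₀) hF h hp1F hx (fun he => ?_) h01' hx0.symm ?_
  · rcases hnb x he with h | h
    · exact hx0 h
    · exact hx2 h
  · intro f hf
    rcases hcov f hf with rfl | hfW
    · exact Or.inl rfl
    by_cases hfx : f = x
    · exact Or.inr (Or.inl hfx)
    refine Or.inr (Or.inr ?_)
    rcases path_split hW hfW (Ne.symm hfx) with h1 | h1
    · exact comp_of_walk (W.takeUntil f hfW)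
        (fun h => hp1 (W.support_takeUntil_subset_support hfW h)) h1
    · refine comp_trans hcon (comp_symm ?_)
      exact comp_of_walk (W.dropUntil f hfW)
        (fun h => hp1 (W.support_dropUntil_subset_support hfW h)) h1

lemma lin (hFc : F.IsCycle) {p₀ p₁ p₂ x y : Fin C.n}
    (h01 : s(p₀, p₁) ∈ F.edges) (h12 : s(p₁, p₂) ∈ F.edges) (h02 : p₀ ≠ p₂)
    (hx : x ∈ F.support) (hy : y ∈ F.support) (hx1 : x ≠ p₁) (hy1 : y ≠ p₁) (hxy : x ≠ y) :
    y ∈ comp C.G p₁ x p₂ ∨ x ∈ comp C.G p₁ y p₂ := by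
  classical
  obtain ⟨W, hW, hp1, hcov, hnb⟩ := open_cycle hFc h01 h12 h02
  have hyW : y ∈ W.support := (hcov y hy).resolve_left hy1
  have hp1' : p₁ ∉ (W.dropUntil y hyW).support :=
    fun h => hp1 (W.support_dropUntil_subset_support hyW h)
  by_cases h1 : x ∈ (W.dropUntil y hyW).support
  · right
    rcases path_split (hW.dropUntil hyW) h1 hxy.symm with h2 | h2
    · exact absurd (SimpleGraph.Walk.start_mem_support _) h2
    · exact comp_symm (comp_of_walk _
        (fun h => hp1' (SimpleGraph.Walk.support_dropUntil_subset_support _ h1 h)) h2)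
  · exact Or.inl (comp_symm (comp_of_walk _ hp1' h1))

lemma bad_nbr (hFc : F.IsCycle) (hF : C.D.BoundsOuter F) {p₀ p₁ p₂ x y : Fin C.n}
    (hP : ∀ z, z ∈ C.P.support ↔ z = p₀ ∨ z = p₁ ∨ z = p₂)
    (h01 : s(p₀, p₁) ∈ F.edges) (h12 : s(p₁, p₂) ∈ F.edges) (h02 : p₀ ≠ p₂)
    (h : C.G.Adj p₁ y) (hy : y ∈ F.support) (hy0 : y ≠ p₀) (hy2 : y ≠ p₂)
    (hx : x ∈ comp C.G p₁ y p₀) (hx0 : C.G.Adj x p₀) (hx1 : C.G.Adj x p₁)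
    (hxy : C.G.Adj x y) {c : ℕ} (hL : C.L x = C.L p₀ ∪ C.L p₁ ∪ {c}) :
    (C.L x).card = 3 ∧ y ∉ comp C.G p₁ x p₀ := by
  have hsep := sep_two hFc hF h01 h12 h02 h hy hy0 hy2
  have hx2 : x ≠ p₂ := by rintro rfl; exact hsep hx
  have hxP : x ∉ C.P.support := by
    rw [hP]
    rintro (h | h | h)
    · exact hx0.ne h
    · exact hx1.ne h
    · exact hx2 h
  have hle : (C.L x).card ≤ 3 := by
    rw [hL]
    have e0 := C.size1 p₀ ((hP _).2 (Or.inl rfl))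
    have e1 := C.size1 p₁ ((hP _).2 (Or.inr (Or.inl rfl)))
    have := Finset.card_union_le (C.L p₀ ∪ C.L p₁) {c}
    have := Finset.card_union_le (C.L p₀) (C.L p₁)
    have : ({c} : Finset ℕ).card = 1 := Finset.card_singleton c
    omega
  have hout : C.D.OnOuter x := by
    by_contra hn
    have := C.size5 x hn
    omega
  have hge := C.size3 x hout hxP
  have hxF := (onOuter_F hF).1 hout
  refine ⟨by omega, fun hcon => ?_⟩
  rcases lin hFc h01 h12 h02 hxF hy hx1.ne h.ne' hxy.ne with h1 | h1
  · exact sep_two hFc hF h01 h12 h02 hx1.symm hxF hx0.ne hx2 (comp_trans hcon (comp_symm h1))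
  · exact hsep (comp_trans hx (comp_symm h1))

lemma bad_sub (hFc : F.IsCycle) (hF : C.D.BoundsOuter F) {p₀ p₁ p₂ y : Fin C.n}
    (hP : ∀ z, z ∈ C.P.support ↔ z = p₀ ∨ z = p₁ ∨ z = p₂)
    (h01 : s(p₀, p₁) ∈ F.edges) (h12 : s(p₁, p₂) ∈ F.edges) (h02 : p₀ ≠ p₂)
    (h : C.G.Adj p₁ y) (hy : y ∈ F.support) (hy0 : y ≠ p₀) (hy2 : y ≠ p₂) {c c' : ℕ}
    (hc : Bad C p₀ p₁ y c) (hc' : Bad C p₀ p₁ y c') : c = c' := by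
  have e0 := C.size1 p₀ ((hP _).2 (Or.inl rfl))
  have e1 := C.size1 p₁ ((hP _).2 (Or.inr (Or.inl rfl)))
  have h01' : C.G.Adj p₀ p₁ := F.adj_of_mem_edges h01
  have key : ∀ {d : ℕ}, C.G.Adj y p₀ → ∀ x ∈ comp C.G p₁ y p₀, C.G.Adj x p₀ → C.G.Adj x p₁ →
      C.G.Adj x y → C.L x = C.L p₀ ∪ C.L p₁ ∪ {d} → False := by
    intro d hyp x hx hx0 hx1 hxy hL
    exact (bad_nbr hFc hF hP h01 h12 h02 h hy hy0 hy2 hx hx0 hx1 hxy hL).2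
      (adj_mem_comp hyp.symm h01'.ne hx0.ne' h.ne' hxy.ne')
  rcases hc with ⟨ha, hb⟩ | ⟨x, hx, hx0, hx1, hxy, hL⟩ <;>
    rcases hc' with ⟨ha', hb'⟩ | ⟨x', hx', hx0', hx1', hxy', hL'⟩
  · exact Finset.card_le_one.1 e0.le _ hb _ hb'
  · exact (key ha x' hx' hx0' hx1' hxy' hL').elim
  · exact (key ha' x hx hx0 hx1 hxy hL).elim
  · obtain ⟨h3, hn⟩ := bad_nbr hFc hF hP h01 h12 h02 h hy hy0 hy2 hx hx0 hx1 hxy hL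
    have hxx : x' = x := by
      by_contra hne
      refine hn (comp_trans (adj_mem_comp hx0'.symm h01'.ne hx0.ne' hx1'.ne hne) ?_)
      exact adj_mem_comp hxy' hx1'.ne hne h.ne' hxy.ne'
    subst hxx
    have hcm : c ∉ C.L p₀ ∪ C.L p₁ := by
      intro hm
      have hs : C.L x' ⊆ C.L p₀ ∪ C.L p₁ := by
        rw [hL]
        exact Finset.union_subset (Finset.Subset.refl _) (Finset.singleton_subset_iff.2 hm)
      have := Finset.card_le_card hs
      have := Finset.card_union_le (C.L p₀) (C.L p₁)
      omega
    have hc : c ∈ C.L x' := by rw [hL]; simp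
    rw [hL', Finset.mem_union, Finset.mem_singleton] at hc
    exact hc.resolve_left hcm

lemma choose_color (hFc : F.IsCycle) (hF : C.D.BoundsOuter F) {p₀ p₁ p₂ y : Fin C.n}
    (hPs : C.P.support = [p₀, p₁, p₂])
    (h01 : s(p₀, p₁) ∈ F.edges) (h12 : s(p₁, p₂) ∈ F.edges) (h02 : p₀ ≠ p₂)
    (h : C.G.Adj p₁ y) (hy : y ∈ F.support) (hy0 : y ≠ p₀) (hy2 : y ≠ p₂) :
    ∃ c ∈ C.L y, c ∉ C.L p₁ ∧ ¬ Bad C p₀ p₁ y c ∧ ¬ Bad C p₂ p₁ y c := by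
  classical
  have hP : ∀ z, z ∈ C.P.support ↔ z = p₀ ∨ z = p₁ ∨ z = p₂ := by
    intro z; rw [hPs]; simp
  have hP' : ∀ z, z ∈ C.P.support ↔ z = p₂ ∨ z = p₁ ∨ z = p₀ := by
    intro z; rw [hP]; tauto
  have h10 : s(p₁, p₀) ∈ F.edges := by rwa [Sym2.eq_swap]
  have h21 : s(p₂, p₁) ∈ F.edges := by rwa [Sym2.eq_swap]
  have e0 := C.size1 p₀ ((hP _).2 (Or.inl rfl))
  have e1 := C.size1 p₁ ((hP _).2 (Or.inr (Or.inl rfl)))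
  have e2 := C.size1 p₂ ((hP _).2 (Or.inr (Or.inr rfl)))
  have hyP : y ∉ C.P.support := by
    rw [hP]
    rintro (e | e | e)
    · exact hy0 e
    · exact h.ne' e
    · exact hy2 e
  have h3 := C.size3 y ((onOuter_F hF).2 hy) hyP
  by_contra hcon
  push Not at hcon
  have hcov : ∀ c ∈ C.L y, c ∈ C.L p₁ ∨ Bad C p₀ p₁ y c ∨ Bad C p₂ p₁ y c := by
    intro c hc
    by_cases h1 : c ∈ C.L p₁
    · exact Or.inl h1
    by_cases h2 : Bad C p₀ p₁ y c
    · exact Or.inr (Or.inl h2)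
    exact Or.inr (Or.inr (hcon c hc h1 h2))
  by_cases h4 : (C.L y).card = 3
  · have hb0 : ∀ c, Bad C p₀ p₁ y c → C.G.Adj y p₀ ∧ c ∈ C.L p₀ := by
      rintro c (hc | ⟨x, hx, hx0, hx1, hxy, hL⟩)
      · exact hc
      · exact absurd h4 (C.no_adjacent_3 x y hxy
          (bad_nbr hFc hF hP h01 h12 h02 h hy hy0 hy2 hx hx0 hx1 hxy hL).1)
    have hb2 : ∀ c, Bad C p₂ p₁ y c → C.G.Adj y p₂ ∧ c ∈ C.L p₂ := by
      rintro c (hc | ⟨x, hx, hx0, hx1, hxy, hL⟩)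
      · exact hc
      · exact absurd h4 (C.no_adjacent_3 x y hxy
          (bad_nbr hFc hF hP' h21 h10 h02.symm h hy hy2 hy0 hx hx0 hx1 hxy hL).1)
    have hu01 := Finset.card_union_le (C.L p₀) (C.L p₁)
    have hu12 := Finset.card_union_le (C.L p₁) (C.L p₂)
    have hu012 := Finset.card_union_le (C.L p₀ ∪ C.L p₁) (C.L p₂)
    by_cases ha0 : C.G.Adj y p₀
    · by_cases ha2 : C.G.Adj y p₂
      · refine C.common_neighbor p₀ p₁ p₂ hPs y ha0 h.symm ha2 ?_
        refine Finset.eq_of_subset_of_card_le (fun c hc => ?_) (by omega)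
        simp only [Finset.mem_union]
        rcases hcov c hc with h1 | h1 | h1
        · exact Or.inl (Or.inr h1)
        · exact Or.inl (Or.inl (hb0 c h1).2)
        · exact Or.inr (hb2 c h1).2
      · have : C.L y ⊆ C.L p₀ ∪ C.L p₁ := fun c hc => by
          simp only [Finset.mem_union]
          rcases hcov c hc with h1 | h1 | h1
          · exact Or.inr h1
          · exact Or.inl (hb0 c h1).2
          · exact absurd (hb2 c h1).1 ha2
        have := Finset.card_le_card this
        omega
    · have : C.L y ⊆ C.L p₁ ∪ C.L p₂ := fun c hc => by
        simp only [Finset.mem_union]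
        rcases hcov c hc with h1 | h1 | h1
        · exact Or.inl h1
        · exact absurd (hb0 c h1).1 ha0
        · exact Or.inr (hb2 c h1).2
      have := Finset.card_le_card this
      omega
  · have hc0 : ((C.L y).filter (Bad C p₀ p₁ y)).card ≤ 1 := by
      rw [Finset.card_le_one]
      intro c hc d hd
      exact bad_sub hFc hF hP h01 h12 h02 h hy hy0 hy2 (Finset.mem_filter.1 hc).2
        (Finset.mem_filter.1 hd).2
    have hc2 : ((C.L y).filter (Bad C p₂ p₁ y)).card ≤ 1 := by
      rw [Finset.card_le_one]
      intro c hc d hd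
      exact bad_sub hFc hF hP' h21 h10 h02.symm h hy hy2 hy0 (Finset.mem_filter.1 hc).2
        (Finset.mem_filter.1 hd).2
    have hsub : C.L y ⊆ C.L p₁ ∪ ((C.L y).filter (Bad C p₀ p₁ y) ∪
        (C.L y).filter (Bad C p₂ p₁ y)) := by
      intro c hc
      simp only [Finset.mem_union, Finset.mem_filter]
      rcases hcov c hc with h1 | h1 | h1
      · exact Or.inl h1
      · exact Or.inr (Or.inl ⟨hc, h1⟩)
      · exact Or.inr (Or.inr ⟨hc, h1⟩)
    have := Finset.card_le_card hsub
    have := Finset.card_union_le (C.L p₁) ((C.L y).filter (Bad C p₀ p₁ y) ∪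
        (C.L y).filter (Bad C p₂ p₁ y))
    have := Finset.card_union_le ((C.L y).filter (Bad C p₀ p₁ y))
        ((C.L y).filter (Bad C p₂ p₁ y))
    omega

lemma color_side (hmin : C.Minimal) (hFc : F.IsCycle) (hF : C.D.BoundsOuter F)
    {p₀ p₁ p₂ y : Fin C.n}
    (hP : ∀ z, z ∈ C.P.support ↔ z = p₀ ∨ z = p₁ ∨ z = p₂)
    (h01 : s(p₀, p₁) ∈ F.edges) (h12 : s(p₁, p₂) ∈ F.edges) (h02 : p₀ ≠ p₂)
    (h : C.G.Adj p₁ y) (hy : y ∈ F.support) (hyF : s(p₁, y) ∉ F.edges)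
    (hy0 : y ≠ p₀) (hy2 : y ≠ p₂) {α β : ℕ}
    (hα : C.L p₁ = {α}) (hne : α ≠ β) (hbad : ¬ Bad C p₀ p₁ y β) :
    ∃ c : Fin C.n → ℕ, c p₁ = α ∧ c y = β ∧ (∀ x ∈ comp C.G p₁ y p₀, c x ∈ C.L x) ∧
      ∀ x ∈ side C.G p₁ y p₀, ∀ z ∈ side C.G p₁ y p₀, C.G.Adj x z → c x ≠ c z := by
  classical
  have hsep := sep_two hFc hF h01 h12 h02 h hy hy0 hy2
  have hadj : C.G.Adj p₀ p₁ := F.adj_of_mem_edges h01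
  have hp0F : p₀ ∈ F.support := F.fst_mem_support_of_mem_edges h01
  have hp1F : p₁ ∈ F.support := F.fst_mem_support_of_mem_edges h12
  have e0 := C.size1 p₀ ((hP _).2 (Or.inl rfl))
  obtain ⟨γ, hγ⟩ := Finset.card_eq_one.1 e0
  have hγα : γ ≠ α := by
    have := C.proper_on_P p₀ ((hP _).2 (Or.inl rfl)) p₁ ((hP _).2 (Or.inr (Or.inl rfl))) hadj
    rw [hγ, hα] at this
    exact fun e => this (by rw [e])
  have hγβ : C.G.Adj y p₀ → γ ≠ β := by
    rintro ha rfl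
    exact hbad (Or.inl ⟨ha, by rw [hγ]; simp⟩)
  let L' : Fin C.n → Finset ℕ := fun x => if x = y then {β} else C.L x
  have hL'y : L' y = {β} := by simp [L']
  have hL'n : ∀ x, x ≠ y → L' x = C.L x := fun x hx => by simp [L', hx]
  have hL0 : L' p₀ = {γ} := by rw [hL'n _ hy0.symm, hγ]
  have hL1 : L' p₁ = {α} := by rw [hL'n _ h.ne, hα]
  obtain ⟨c, hc1, hc2⟩ := sub_color C hmin (side C.G p₁ y p₀)
    (side_ne_univ hF h hp1F hy hyF hadj.ne hy0.symm)
    (SimpleGraph.Walk.cons hadj (SimpleGraph.Walk.cons h SimpleGraph.Walk.nil))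
    (by simp [h.ne, hadj.ne, hy0.symm]) (by simp)
    (by
      intro x hx
      simp only [SimpleGraph.Walk.support_cons, SimpleGraph.Walk.support_nil, List.mem_cons,
        List.not_mem_nil, or_false] at hx
      rcases hx with rfl | rfl | rfl
      · exact Or.inr (Or.inr (self_mem_comp _ _ _ _))
      · exact Or.inl rfl
      · exact Or.inr (Or.inl rfl))
    (by
      intro x hx
      simp only [SimpleGraph.Walk.support_cons, SimpleGraph.Walk.support_nil, List.mem_cons,
        List.not_mem_nil, or_false] at hx
      rcases hx with rfl | rfl | rfl
      · exact F_pos hF _ hp0F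
      · exact F_pos hF _ hp1F
      · exact F_pos hF _ hy)
    (by
      intro x z hxz he
      simp only [SimpleGraph.Walk.edges_cons, SimpleGraph.Walk.edges_nil, List.mem_cons,
        List.not_mem_nil, or_false] at he
      rcases he with he | he
      · exact F_arc hF _ hxz (he ▸ h01)
      · rw [Sym2.eq_iff] at he
        rcases he with ⟨rfl, rfl⟩ | ⟨rfl, rfl⟩
        · exact chord_arc hF h hp1F hy hadj.ne hy0.symm
        · rw [arcSet_symm C.D h]
          exact chord_arc hF h hp1F hy hadj.ne hy0.symm)
    L'
    (by
      intro x hx hxQ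
      simp only [SimpleGraph.Walk.support_cons, SimpleGraph.Walk.support_nil, List.mem_cons,
        List.not_mem_nil, or_false, not_or] at hxQ
      refine ⟨hL'n _ hxQ.2.2, ?_⟩
      rw [hP]
      rintro (e | e | e)
      · exact hxQ.1 e
      · exact hxQ.2.1 e
      · subst e
        rcases hx with h1 | h1 | h1
        · exact hxQ.2.1 h1
        · exact hxQ.2.2 h1
        · exact hsep h1)
    (by
      intro x hx
      simp only [SimpleGraph.Walk.support_cons, SimpleGraph.Walk.support_nil, List.mem_cons,
        List.not_mem_nil, or_false] at hx
      rcases hx with rfl | rfl | rfl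
      · rw [hL0]; simp
      · rw [hL1]; simp
      · rw [hL'y]; simp)
    (by
      intro x hx z hz hxz
      simp only [SimpleGraph.Walk.support_cons, SimpleGraph.Walk.support_nil, List.mem_cons,
        List.not_mem_nil, or_false] at hx hz
      rcases hx with hx | hx | hx <;> rcases hz with hz | hz | hz <;> rw [hx, hz] at hxz ⊢
      · exact absurd hxz (C.G.irrefl)
      · rw [hL0, hL1]; simpa using hγα
      · rw [hL0, hL'y]; simpa using hγβ hxz.symm
      · rw [hL0, hL1]; simpa using hγα.symm
      · exact absurd hxz (C.G.irrefl)
      · rw [hL1, hL'y]; simpa using hne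
      · rw [hL0, hL'y]; simpa using (hγβ hxz).symm
      · rw [hL1, hL'y]; simpa using hne.symm
      · exact absurd hxz (C.G.irrefl))
    (by
      intro q₀ q₁ q₂ hs x hx h0 h1 h2 hL
      simp only [SimpleGraph.Walk.support_cons, SimpleGraph.Walk.support_nil, List.cons.injEq,
        and_true] at hs
      obtain ⟨rfl, rfl, rfl⟩ := hs
      rw [hL'n x h2.ne, hL'y, hL'n _ hy0.symm, hL'n _ h.ne] at hL
      refine hbad (Or.inr ⟨x, ?_, h0, h1, h2, hL⟩)
      rcases hx with h3 | h3 | h3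
      · exact absurd h3 h1.ne
      · exact absurd h3 h2.ne
      · exact h3)
  refine ⟨c, ?_, ?_, ?_, hc2⟩
  · have := hc1 p₁ (Or.inl rfl)
    rw [hL1] at this
    simpa using this
  · have := hc1 y (Or.inr (Or.inl rfl))
    rw [hL'y] at this
    simpa using this
  · intro x hx
    have := hc1 x (Or.inr (Or.inr hx))
    rwa [hL'n x (comp_ne hadj.ne hy0.symm hx).2] at this

/-- A chord at the middle vertex of the precolored path is impossible. -/
lemma case_two (hmin : C.Minimal) (hFc : F.IsCycle) (hF : C.D.BoundsOuter F)
    {p₀ p₁ p₂ y : Fin C.n} (hPs : C.P.support = [p₀, p₁, p₂])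
    (h01 : s(p₀, p₁) ∈ F.edges) (h12 : s(p₁, p₂) ∈ F.edges) (h02 : p₀ ≠ p₂)
    (h : C.G.Adj p₁ y) (hy : y ∈ F.support) (hyF : s(p₁, y) ∉ F.edges)
    (hy0 : y ≠ p₀) (hy2 : y ≠ p₂) : False := by
  have hP : ∀ z, z ∈ C.P.support ↔ z = p₀ ∨ z = p₁ ∨ z = p₂ := by
    intro z; rw [hPs]; simp
  have hP' : ∀ z, z ∈ C.P.support ↔ z = p₂ ∨ z = p₁ ∨ z = p₀ := by
    intro z; rw [hP]; tauto
  have h10 : s(p₁, p₀) ∈ F.edges := by rwa [Sym2.eq_swap]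
  have h21 : s(p₂, p₁) ∈ F.edges := by rwa [Sym2.eq_swap]
  have hp1F : p₁ ∈ F.support := F.fst_mem_support_of_mem_edges h12
  obtain ⟨β, hβ, hβ1, hb0, hb2⟩ := choose_color hFc hF hPs h01 h12 h02 h hy hy0 hy2
  obtain ⟨α, hα⟩ := Finset.card_eq_one.1 (C.size1 p₁ ((hP _).2 (Or.inr (Or.inl rfl))))
  have hne : α ≠ β := by
    rintro rfl
    exact hβ1 (by rw [hα]; simp)
  refine C.not_colorable (glue (u := p₁) (v := y) (α := α) (by rw [hα]; simp) hβ hne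
    (fun w h1 h2 => ?_) h.ne)
  by_cases hw0 : w ∈ comp C.G p₁ y p₀
  · unfold side
    rw [comp_eq hw0]
    exact color_side hmin hFc hF hP h01 h12 h02 h hy hyF hy0 hy2 hα hne hb0
  by_cases hw2 : w ∈ comp C.G p₁ y p₂
  · unfold side
    rw [comp_eq hw2]
    exact color_side hmin hFc hF hP' h21 h10 h02.symm h hy hyF hy2 hy0 hα hne hb2
  refine other_comp hmin hF h hp1F hy hyF h1 h2 (fun x hx hxP => ?_) hne
  rcases (hP x).1 hxP with rfl | rfl | rfl
  · exact hw0 (comp_symm hx)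
  · exact (comp_ne h1 h2 hx).1 rfl
  · exact hw2 (comp_symm hx)

lemma P_edge (hF : C.D.BoundsOuter F) {x y : Fin C.n} (h : s(x, y) ∈ C.P.edges) :
    s(x, y) ∈ F.edges := by
  have hadj := C.P.adj_of_mem_edges h
  refine mem_edges_of_arc C.plane hadj ?_
  rw [← show frontier C.D.outerFace = C.D.walkSet F from hF]
  exact C.P_boundary (arc_walkSet _ hadj h ⟨_, rfl⟩)

lemma walk_short {V : Type} {G : SimpleGraph V} {a b : V} (P : G.Walk a b) (hl : P.length ≤ 2) :
    P.support = [a] ∨ (P.support = [a, b] ∧ G.Adj a b) ∨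
      ∃ m, P.support = [a, m, b] ∧ P.edges = [s(a, m), s(m, b)] := by
  cases P with
  | nil => simp
  | cons h P =>
    cases P with
    | nil => simp [h]
    | cons h' P =>
      cases P with
      | nil => simp
      | cons h'' P => simp at hl

/-- The main argument. -/
lemma no_chord (hmin : C.Minimal) (hFc : F.IsCycle) (hF : C.D.BoundsOuter F)
    {u v : Fin C.n} (h : C.G.Adj u v) (hu : u ∈ F.support) (hv : v ∈ F.support) :
    s(u, v) ∈ F.edges := by
  by_contra huv
  have c1 : ∀ w, w ≠ u → w ≠ v → ¬ ∀ x ∈ C.P.support, x ∈ side C.G u v w :=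
    fun w h1 h2 => case_one hmin hF h hu hv huv h1 h2
  obtain ⟨w, hwu, hwv⟩ : ∃ w, w ≠ u ∧ w ≠ v := by
    by_contra hcon
    push Not at hcon
    cases F with
    | nil => exact hFc.ne_nil rfl
    | @cons _ z _ hrz q =>
      have hr : r = u ∨ r = v := by
        by_cases e : r = u
        · exact Or.inl e
        · exact Or.inr (hcon r e)
      have hz : z = u ∨ z = v := by
        by_cases e : z = u
        · exact Or.inl e
        · exact Or.inr (hcon z e)
      apply huv
      rw [SimpleGraph.Walk.edges_cons]
      refine List.mem_cons.2 (Or.inl ?_)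
      have := hrz.ne
      rcases hr with e | e <;> rcases hz with e' | e'
      · exact absurd (e.trans e'.symm) this
      · rw [e, e']
      · rw [e, e', Sym2.eq_swap]
      · exact absurd (e.trans e'.symm) this
  have self : ∀ x, x ∈ side C.G u v x := fun x => Or.inr (Or.inr (self_mem_comp _ _ _ _))
  -- a pair of vertices lying on a common side gives a contradiction
  have one : ∀ x, ∃ w, (w ≠ u ∧ w ≠ v) ∧ x ∈ side C.G u v w := by
    intro x
    by_cases h1 : x = u
    · exact ⟨w, ⟨hwu, hwv⟩, Or.inl h1⟩
    by_cases h2 : x = v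
    · exact ⟨w, ⟨hwu, hwv⟩, Or.inr (Or.inl h2)⟩
    exact ⟨x, ⟨h1, h2⟩, self x⟩
  have two : ∀ x y, (C.G.Adj x y ∨ x = u ∨ x = v) →
      ∃ w, (w ≠ u ∧ w ≠ v) ∧ x ∈ side C.G u v w ∧ y ∈ side C.G u v w := by
    intro x y hxy
    by_cases h1 : x = u
    · obtain ⟨w, hw, hy⟩ := one y
      exact ⟨w, hw, Or.inl h1, hy⟩
    by_cases h2 : x = v
    · obtain ⟨w, hw, hy⟩ := one y
      exact ⟨w, hw, Or.inr (Or.inl h2), hy⟩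
    refine ⟨x, ⟨h1, h2⟩, self x, ?_⟩
    by_cases h3 : y = u
    · exact Or.inl h3
    by_cases h4 : y = v
    · exact Or.inr (Or.inl h4)
    exact Or.inr (Or.inr (adj_mem_comp (by tauto) h1 h2 h3 h4))
  rcases walk_short C.P C.P_len with hs | ⟨hs, hadj⟩ | ⟨m, hs, he⟩
  · obtain ⟨w, hw, hx⟩ := one C.a
    exact c1 w hw.1 hw.2 (by rw [hs]; simpa using hx)
  · obtain ⟨w, hw, hx, hy⟩ := two C.a C.b (Or.inl hadj)
    exact c1 w hw.1 hw.2 (by rw [hs]; simpa using ⟨hx, hy⟩)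
  · have h01 : s(C.a, m) ∈ F.edges := P_edge hF (by rw [he]; simp)
    have h12 : s(m, C.b) ∈ F.edges := P_edge hF (by rw [he]; simp)
    have ham : C.G.Adj C.a m := F.adj_of_mem_edges h01
    have hmb : C.G.Adj m C.b := F.adj_of_mem_edges h12
    have hab : C.a ≠ C.b := by
      have := C.P_path.support_nodup
      rw [hs] at this
      simp at this
      tauto
    have c1' : ∀ w, w ≠ u → w ≠ v → C.a ∈ side C.G u v w → m ∈ side C.G u v w →
        C.b ∈ side C.G u v w → False := by
      intro w h1 h2 h3 h4 h5
      exact c1 w h1 h2 (by rw [hs]; simpa using ⟨h3, h4, h5⟩)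
    have ha : C.a ≠ u ∧ C.a ≠ v := by
      by_contra hcon
      have hcon' : C.a = u ∨ C.a = v := by tauto
      obtain ⟨w, hw, hx, hy⟩ := two m C.b (Or.inl hmb)
      refine c1' w hw.1 hw.2 ?_ hx hy
      rcases hcon' with e | e
      · exact Or.inl e
      · exact Or.inr (Or.inl e)
    have hb : C.b ≠ u ∧ C.b ≠ v := by
      by_contra hcon
      have hcon' : C.b = u ∨ C.b = v := by tauto
      obtain ⟨w, hw, hx, hy⟩ := two C.a m (Or.inl ham)
      refine c1' w hw.1 hw.2 hx hy ?_
      rcases hcon' with e | e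
      · exact Or.inl e
      · exact Or.inr (Or.inl e)
    by_cases hm1 : m = u
    · subst hm1
      exact case_two hmin hFc hF hs h01 h12 hab h hv huv ha.2.symm hb.2.symm
    by_cases hm2 : m = v
    · subst hm2
      exact case_two hmin hFc hF hs h01 h12 hab h.symm hu (by rwa [Sym2.eq_swap]) ha.1.symm hb.1.symm
    exact c1' m hm1 hm2 (Or.inr (Or.inr (adj_mem_comp ham.symm hm1 hm2 ha.1 ha.2))) (self m)
      (Or.inr (Or.inr (adj_mem_comp hmb hm1 hm2 hb.1 hb.2)))

end CaseTwo

end NC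
/-- In a minimal counterexample configuration for the precolored-path 5-choosability
theorem, the cycle `F` bounding the outer face has no chords: any edge of the graph
joining two vertices of `F` is an edge of `F`. -/
theorem minimal_counterexample_no_chords
    (C : Config) (hmin : C.Minimal)
    {r : Fin C.n} (F : C.G.Walk r r) (hFcyc : F.IsCycle) (hFbd : C.D.BoundsOuter F) :
    ∀ u v : Fin C.n, C.G.Adj u v → u ∈ F.support → v ∈ F.support →
      s(u, v) ∈ F.edges := by
  intro u v h hu hv
  exact NC.no_chord hmin hFcyc hFbd h hu hv
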